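/- arXiv:2006.06724 — 4 statements merged into one kernel-verified Lean document; each statement's English description precedes it below -/
import Mathlib

section
/- For integers 1 ≤ k < n, the number of labelled trees on vertex set {1,…,n} in which {1,…,k} is an independent set equals (n−k)^{k−1} · n^{n−k−1}. -/
open scoped Classical

/-- Every vertex eventually reaches the fixed point `r` under iteration of the parent map `f`. -/
def IsParentMap {V : Type*} (r : V) (f : V → V) : Prop :=
  f r = r ∧ ∀ x, ∃ m : ℕ, f^[m] x = r

/-- The graph joining each vertex to its image under `f`. -/
def parentGraph {V : Type*} (f : V → V) : SimpleGraph V :=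
  SimpleGraph.fromRel fun x y => f x = y

namespace IsParentMap

variable {V : Type*} {r : V} {f g : V → V}

theorem eq_root_of_isPeriodicPt (hf : IsParentMap r f) {x : V} {p : ℕ} (hp : 0 < p)
    (hx : f^[p] x = x) : x = r := by
  obtain ⟨m, hm⟩ := hf.2 x
  have h₁ : f^[m * p] x = x := by
    rw [mul_comm, Function.iterate_mul]
    exact Function.iterate_fixed hx m
  have h₂ : f^[m * p] x = r := by
    obtain ⟨d, hd⟩ := Nat.exists_eq_add_of_le (Nat.le_mul_of_pos_right m hp)
    rw [hd, add_comm, Function.iterate_add_apply, hm, Function.iterate_fixed hf.1]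
  exact h₁.symm.trans h₂

theorem apply_ne (hf : IsParentMap r f) {x : V} (hx : x ≠ r) : f x ≠ x := fun h =>
  hx (hf.eq_root_of_isPeriodicPt one_pos h)

theorem exists_uniform_iterate [Finite V] (hf : IsParentMap r f) :
    ∃ m : ℕ, ∀ x, f^[m] x = r := by
  have := Fintype.ofFinite V
  choose m hm using hf.2
  refine ⟨Finset.univ.sup m, fun x => ?_⟩
  obtain ⟨d, hd⟩ := Nat.exists_eq_add_of_le (Finset.le_sup (f := m) (Finset.mem_univ x))
  rw [hd, add_comm, Function.iterate_add_apply, hm, Function.iterate_fixed hf.1]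

theorem connected_parentGraph (hf : IsParentMap r f) : (parentGraph f).Connected := by
  have step (x : V) : (parentGraph f).Reachable x (f x) := by
    by_cases h : x = f x
    · rw [← h]
    · exact SimpleGraph.Adj.reachable ⟨h, Or.inl rfl⟩
  have reach (m : ℕ) : ∀ x, (parentGraph f).Reachable x (f^[m] x) := by
    induction m with
    | zero => exact fun x => SimpleGraph.Reachable.refl _
    | succ m ih => exact fun x => (step x).trans (ih (f x))
  have root (x : V) : (parentGraph f).Reachable x r := by
    obtain ⟨m, hm⟩ := hf.2 x
    exact hm ▸ reach m x
  exact { preconnected := fun x y => (root x).trans (root y).symm, nonempty := ⟨r⟩ }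

theorem isTree_parentGraph [Finite V] (hf : IsParentMap r f) : (parentGraph f).IsTree := by
  rw [SimpleGraph.isTree_iff_connected_and_card]
  refine ⟨hf.connected_parentGraph,
    le_antisymm ?_ hf.connected_parentGraph.card_vert_le_card_edgeSet_add_one⟩
  have hsub : (parentGraph f).edgeSet ⊆ (fun x => s(x, f x)) '' {r}ᶜ := by
    intro e
    induction e with
    | h x y =>
      rintro ⟨hne, h⟩
      dsimp only at hne h
      rcases h with rfl | rfl
      · exact ⟨x, fun h => hne (by rw [Set.mem_singleton_iff.1 h, hf.1]), rfl⟩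
      · exact ⟨y, fun h => hne (by rw [Set.mem_singleton_iff.1 h, hf.1]), Sym2.eq_swap⟩
  have hle := (Set.ncard_le_ncard hsub).trans (Set.ncard_image_le (Set.toFinite _))
  have hcompl := Set.ncard_add_ncard_compl ({r} : Set V)
  rw [Set.ncard_singleton] at hcompl
  rw [Nat.card_coe_set_eq]
  omega

theorem eq_of_parentGraph_eq (hf : IsParentMap r f) (hg : IsParentMap r g)
    (h : parentGraph f = parentGraph g) : f = g := by
  have key (m : ℕ) : ∀ x, g^[m] x = r → f x = g x := by
    induction m with
    | zero =>
      rintro x rfl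
      exact hf.1.trans hg.1.symm
    | succ m ih =>
      intro x hx
      by_cases hxr : x = r
      · rw [hxr, hf.1, hg.1]
      have hadj : (parentGraph g).Adj x (g x) := ⟨(hg.apply_ne hxr).symm, Or.inl rfl⟩
      rw [← h] at hadj
      rcases hadj.2 with h₁ | h₁
      · exact h₁
      · exact (hxr (hg.eq_root_of_isPeriodicPt two_pos ((ih (g x) hx).symm.trans h₁))).elim
  funext x
  obtain ⟨m, hm⟩ := hg.2 x
  exact key m x hm

end IsParentMap

theorem SimpleGraph.IsTree.exists_parentGraph_eq {V : Type*} {G : SimpleGraph V} (hG : G.IsTree)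
    (r : V) : ∃ f, IsParentMap r f ∧ parentGraph f = G := by
  have hstep (x : V) : ∃ y, (x = r → y = r) ∧ (x ≠ r → G.Adj x y ∧ G.dist y r < G.dist x r) := by
    by_cases hx : x = r
    · exact ⟨r, fun _ => rfl, fun h => (h hx).elim⟩
    obtain ⟨p, hp⟩ := hG.connected.exists_walk_length_eq_dist x r
    cases p with
    | nil => exact (hx rfl).elim
    | @cons _ y _ hadj q =>
      refine ⟨y, fun h => (hx h).elim, fun _ => ⟨hadj, ?_⟩⟩
      have := SimpleGraph.dist_le q
      rw [SimpleGraph.Walk.length_cons] at hp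
      omega
  choose f hf₀ hf₁ using hstep
  have hreach (d : ℕ) : ∀ x, G.dist x r ≤ d → ∃ m : ℕ, f^[m] x = r := by
    induction d with
    | zero =>
      intro x hx
      exact ⟨0, hG.connected.dist_eq_zero_iff.1 (Nat.le_zero.1 hx)⟩
    | succ d ih =>
      intro x hx
      by_cases hxr : x = r
      · exact ⟨0, hxr⟩
      obtain ⟨m, hm⟩ := ih (f x) (by have := (hf₁ x hxr).2; omega)
      exact ⟨m + 1, hm⟩
  have hf : IsParentMap r f := ⟨hf₀ r rfl, fun x => hreach _ x le_rfl⟩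
  have hle : parentGraph f ≤ G := by
    rintro x y ⟨hne, rfl | rfl⟩
    · exact (hf₁ x fun h => hne (by rw [h, hf.1])).1
    · exact (hf₁ y fun h => hne (by rw [h, hf.1])).1.symm
  exact ⟨f, hf, le_antisymm hle
    ((SimpleGraph.isTree_iff_minimal_connected.1 hG).2 hf.connected_parentGraph hle)⟩

section Determinant

open Matrix

variable {V : Type*} [Fintype V] [DecidableEq V] {r : V} {f : V → V}

/-- The matrix of the partial map obtained from `f` by deleting the value `r`. -/
def partialMapMatrix (r : V) (f : V → V) : Matrix V V ℚ :=
  Matrix.of fun x y => if f x = y ∧ y ≠ r then 1 else 0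

theorem partialMapMatrix_pow_succ (hr : f r = r) (m : ℕ) :
    partialMapMatrix r f ^ (m + 1) = partialMapMatrix r f^[m + 1] := by
  induction m with
  | zero => simp
  | succ m ih =>
    rw [pow_succ', ih]
    ext x y
    have hfix := Function.iterate_fixed hr (m + 1)
    by_cases hx : f x = r
    · have hit : f^[m + 1 + 1] x = r := by rw [Function.iterate_succ_apply, hx, hfix]
      rw [Matrix.mul_apply]
      simp only [partialMapMatrix, Matrix.of_apply, hit, hx]
      rw [Finset.sum_eq_zero, if_neg]
      · rintro ⟨h₁, h₂⟩
        exact h₂ h₁.symm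
      · intro z _
        rw [if_neg, zero_mul]
        rintro ⟨h₁, h₂⟩
        exact h₂ h₁.symm
    · rw [Matrix.mul_apply, Finset.sum_eq_single (f x)]
      · simp only [partialMapMatrix, Matrix.of_apply, ne_eq, hx, not_false_eq_true, and_self,
          if_true, one_mul, Function.iterate_succ_apply]
        congr
      · intro z _ hz
        simp [partialMapMatrix, hz.symm]
      · simp

theorem IsParentMap.isNilpotent_partialMapMatrix (hf : IsParentMap r f) :
    IsNilpotent (partialMapMatrix r f) := by
  obtain ⟨m, hm⟩ := hf.exists_uniform_iterate
  refine ⟨m + 1, ?_⟩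
  rw [partialMapMatrix_pow_succ hf.1]
  ext x y
  have : f^[m + 1] x = r := by rw [Function.iterate_succ_apply, hm]
  simp only [partialMapMatrix, Matrix.of_apply, this, Matrix.zero_apply]
  rw [if_neg]
  rintro ⟨h₁, h₂⟩
  exact h₂ h₁.symm

theorem Matrix.det_one_sub_of_isNilpotent {K : Type*} [Field K] {M : Matrix V V K}
    (hM : IsNilpotent M) : (1 - M).det = 1 := by
  have h := (Matrix.isNilpotent_charpoly_sub_pow_of_isNilpotent hM).eq_zero
  have h' := Matrix.eval_charpoly M 1
  rw [sub_eq_zero.1 h] at h'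
  simpa using h'.symm

theorem det_one_sub_partialMapMatrix (hr : f r = r) :
    (1 - partialMapMatrix r f).det = if IsParentMap r f then 1 else 0 := by
  split_ifs with hf
  · exact Matrix.det_one_sub_of_isNilpotent hf.isNilpotent_partialMapMatrix
  · rw [← Matrix.exists_mulVec_eq_zero_iff]
    have hx : ∃ x, ∀ m : ℕ, f^[m] x ≠ r := by
      by_contra! h
      exact hf ⟨hr, h⟩
    obtain ⟨x₀, hx₀⟩ := hx
    refine ⟨fun x => if ∀ m : ℕ, f^[m] x ≠ r then 1 else 0, fun h => ?_, ?_⟩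
    · have := congrFun h x₀
      simp [hx₀] at this
    · rw [Matrix.sub_mulVec, Matrix.one_mulVec, sub_eq_zero]
      funext x
      have hiff : (∀ m : ℕ, f^[m] x ≠ r) ↔ (f x ≠ r ∧ ∀ m : ℕ, f^[m] (f x) ≠ r) := by
        constructor
        · exact fun h => ⟨h 1, fun m => h (m + 1)⟩
        · rintro ⟨h₁, h₂⟩ (_ | m)
          · rintro rfl
            exact h₁ hr
          · exact h₂ m
      rw [Matrix.mulVec, dotProduct, Finset.sum_eq_single (f x)]
      · simp only [partialMapMatrix, Matrix.of_apply, if_true, hiff, ite_and, ite_mul, one_mul,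
          zero_mul]
      · intro z _ hz
        simp [partialMapMatrix, hz.symm]
      · simp

/-- A form of the directed **matrix-tree theorem**: counting parent maps with prescribed sets of
allowed parents. -/
theorem card_parentMaps_eq_det (S : V → Finset V) (hS : S r = {r}) :
    (((Fintype.piFinset S).filter (IsParentMap r)).card : ℚ) =
      (Matrix.of fun x y => ∑ z ∈ S x, ((1 : Matrix V V ℚ) x y -
        if z = y ∧ y ≠ r then 1 else 0)).det := by
  have hrows : (Matrix.of fun x y => ∑ z ∈ S x, ((1 : Matrix V V ℚ) x y -
      if z = y ∧ y ≠ r then 1 else 0)) =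
      fun x => ∑ z ∈ S x, fun y => ((1 : Matrix V V ℚ) x y - if z = y ∧ y ≠ r then 1 else 0) := by
    ext x y
    simp only [Matrix.of_apply, Finset.sum_apply]
  rw [hrows]
  have hexpand := (Matrix.detRowAlternating (R := ℚ) (n := V)).toMultilinearMap.map_sum_finset
    (fun x z y => ((1 : Matrix V V ℚ) x y - if z = y ∧ y ≠ r then 1 else 0)) S
  refine Eq.trans ?_ hexpand.symm
  rw [Finset.card_filter, Nat.cast_sum]
  refine Finset.sum_congr rfl fun f hf => ?_
  have hr : f r = r := by simpa [hS] using Fintype.mem_piFinset.1 hf r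
  rw [Nat.cast_ite, Nat.cast_one, Nat.cast_zero]
  exact (det_one_sub_partialMapMatrix hr).symm

end Determinant

/-- The vertices that may be parents of `x` when `{0, …, k - 1}` is independent and `r` is the
root. -/
def allowedParents {n : ℕ} (k : ℕ) (r x : Fin n) : Finset (Fin n) :=
  if x = r then {r} else if (x : ℕ) < k then Finset.univ.filter fun y => k ≤ (y : ℕ)
  else Finset.univ

theorem Fin.card_filter_le_val (n k : ℕ) :
    (Finset.univ.filter fun y : Fin n => k ≤ (y : ℕ)).card = n - k := by
  have h := Finset.card_filter_add_card_filter_not (s := (Finset.univ : Finset (Fin n)))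
    (fun y => (y : ℕ) < k)
  simp only [not_lt, Finset.card_univ, Fintype.card_fin, Fin.card_filter_val_lt] at h
  omega

theorem det_allowedParents {n k : ℕ} (hk : 1 ≤ k) (hkn : k < n) {r : Fin n} (hr : k ≤ (r : ℕ)) :
    (Matrix.of fun x y => ∑ z ∈ allowedParents k r x, ((1 : Matrix (Fin n) (Fin n) ℚ) x y -
        if z = y ∧ y ≠ r then 1 else 0)).det = ((n - k) ^ (k - 1) * n ^ (n - k - 1) : ℕ) := by
  have hn₀ : (n : ℚ) ≠ 0 := by
    rw [Nat.cast_ne_zero]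
    omega
  have hnk₀ : ((n : ℚ) - k) ≠ 0 := sub_ne_zero.2 (by exact_mod_cast hkn.ne')
  have hcast : ((n - k : ℕ) : ℚ) = n - k := Nat.cast_sub hkn.le
  have hcast' : ((n - k - 1 : ℕ) : ℚ) = n - k - 1 := by
    rw [Nat.cast_sub (by omega), hcast, Nat.cast_one]
  have hcardA : (Finset.univ.filter fun x : Fin n => (x : ℕ) < k).card = k := by
    rw [Fin.card_filter_val_lt, min_eq_right hkn.le]
  have hcardB : (Finset.univ.filter fun x : Fin n => x ≠ r ∧ k ≤ (x : ℕ)).card = n - k - 1 := by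
    have : (Finset.univ.filter fun x : Fin n => x ≠ r ∧ k ≤ (x : ℕ)) =
        (Finset.univ.filter fun x : Fin n => k ≤ (x : ℕ)).erase r := by
      ext x
      simp
    rw [this, Finset.card_erase_of_mem (by simpa using hr), Fin.card_filter_le_val]
  let d : Fin n → ℚ := fun x => (if (x : ℕ) < k then (n - k : ℚ) else 1) *
    if x ≠ r ∧ k ≤ (x : ℕ) then (n : ℚ) else 1
  let P : Matrix (Fin n) (Fin 2) ℚ := Matrix.of fun x =>
    ![if x ≠ r ∧ k ≤ (x : ℕ) then (n : ℚ)⁻¹ else 0, if (x : ℕ) < k then (n - k : ℚ)⁻¹ else 0]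
  let Q : Matrix (Fin 2) (Fin n) ℚ := Matrix.of
    ![fun y => if y ≠ r then 1 else 0, fun y => if y ≠ r ∧ k ≤ (y : ℕ) then 1 else 0]
  have hfactor : (Matrix.of fun x y => ∑ z ∈ allowedParents k r x,
      ((1 : Matrix (Fin n) (Fin n) ℚ) x y - if z = y ∧ y ≠ r then 1 else 0)) =
      Matrix.diagonal d * (1 - P * Q) := by
    ext x y
    rw [Matrix.diagonal_mul, Matrix.of_apply, Finset.sum_sub_distrib, Finset.sum_const,
      nsmul_eq_mul]
    have hsum : (∑ z ∈ allowedParents k r x, if z = y ∧ y ≠ r then (1 : ℚ) else 0) =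
        if y ∈ allowedParents k r x ∧ y ≠ r then 1 else 0 := by
      by_cases hy : y = r <;> simp [hy]
    rw [hsum, Matrix.sub_apply, Matrix.mul_apply, Fin.sum_univ_two]
    by_cases hxr : x = r
    · subst hxr
      simp [allowedParents, d, P, hr.not_gt]
    · by_cases hxk : (x : ℕ) < k
      · simp only [allowedParents, if_neg hxr, if_pos hxk, Fin.card_filter_le_val, hcast]
        by_cases hy : y = r <;> by_cases hyk : k ≤ (y : ℕ) <;>
          simp [d, P, Q, hxk, hxk.not_ge, hy, hyk] <;> field_simp
      · have hxk' : k ≤ (x : ℕ) := not_lt.1 hxk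
        by_cases hy : y = r <;>
          simp [allowedParents, d, P, Q, hxr, hxk, hxk', hy] <;> field_simp
  have hd : ∏ x, d x = ((n : ℚ) - k) ^ k * (n : ℚ) ^ (n - k - 1) := by
    simp only [d]
    rw [Finset.prod_mul_distrib, ← Finset.prod_filter, ← Finset.prod_filter, Finset.prod_const,
      Finset.prod_const, hcardA, hcardB]
  have hsumA (c : ℚ) : (∑ x : Fin n, if (x : ℕ) < k then c else 0) = k * c := by
    rw [← Finset.sum_filter, Finset.sum_const, hcardA, nsmul_eq_mul]
  have hsumB (c : ℚ) : (∑ x : Fin n, if x ≠ r ∧ k ≤ (x : ℕ) then c else 0) =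
      (n - k - 1) * c := by
    rw [← Finset.sum_filter, Finset.sum_const, hcardB, nsmul_eq_mul, hcast']
  have h₀₀ : (Q * P) 0 0 = (n - k - 1) * (n : ℚ)⁻¹ := by
    rw [Matrix.mul_apply, ← hsumB]
    refine Finset.sum_congr rfl fun x _ => ?_
    by_cases hx : x = r <;> simp [P, Q, hx]
  have h₀₁ : (Q * P) 0 1 = k * (n - k : ℚ)⁻¹ := by
    rw [Matrix.mul_apply, ← hsumA]
    refine Finset.sum_congr rfl fun x _ => ?_
    by_cases hx : x = r <;> simp [P, Q, hx, hr.not_gt]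
  have h₁₀ : (Q * P) 1 0 = (n - k - 1) * (n : ℚ)⁻¹ := by
    rw [Matrix.mul_apply, ← hsumB]
    refine Finset.sum_congr rfl fun x _ => ?_
    by_cases hx : x = r <;> by_cases hxk : k ≤ (x : ℕ) <;> simp [P, Q, hx, hxk]
  have h₁₁ : (Q * P) 1 1 = 0 := by
    rw [Matrix.mul_apply]
    refine Finset.sum_eq_zero fun x _ => ?_
    by_cases hx : (x : ℕ) < k
    · simp [P, Q, hx.not_ge]
    · simp [P, Q, hx]
  rw [hfactor, Matrix.det_mul, Matrix.det_diagonal, hd, Matrix.det_one_sub_mul_comm,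
    Matrix.det_fin_two]
  simp only [Matrix.sub_apply, h₀₀, h₀₁, h₁₀, h₁₁, Matrix.one_apply_eq,
    Matrix.one_apply_ne zero_ne_one, Matrix.one_apply_ne one_ne_zero]
  push_cast [hcast]
  obtain ⟨k, rfl⟩ := Nat.exists_eq_add_of_le' hk
  rw [Nat.add_sub_cancel, pow_succ]
  field_simp
  ring

theorem independent_parentGraph_iff {n k : ℕ} {r : Fin n} (hr : k ≤ (r : ℕ)) {f : Fin n → Fin n}
    (hf : IsParentMap r f) :
    (∀ x y : Fin n, (x : ℕ) < k → (y : ℕ) < k → ¬ (parentGraph f).Adj x y) ↔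
      f ∈ Fintype.piFinset (allowedParents k r) := by
  rw [Fintype.mem_piFinset]
  constructor
  · intro h x
    unfold allowedParents
    split_ifs with hxr hxk
    · simp [hxr, hf.1]
    · rw [Finset.mem_filter]
      refine ⟨Finset.mem_univ _, ?_⟩
      by_contra! hfx
      exact h x (f x) hxk hfx ⟨(hf.apply_ne hxr).symm, Or.inl rfl⟩
    · exact Finset.mem_univ _
  · intro h
    have key (x : Fin n) (hx : (x : ℕ) < k) : k ≤ (f x : ℕ) := by
      have hxr : x ≠ r := by
        rintro rfl
        omega
      have := h x
      rw [allowedParents, if_neg hxr, if_pos hx, Finset.mem_filter] at this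
      exact this.2
    rintro x y hx hy ⟨-, rfl | rfl⟩
    · exact (key x hx).not_gt hy
    · exact (key y hy).not_gt hx

theorem count_trees_with_independent_set (n k : ℕ) (hk : 1 ≤ k) (hkn : k < n) :
    Set.ncard {G : SimpleGraph (Fin n) | G.IsTree ∧
        ∀ x y : Fin n, (x : ℕ) < k → (y : ℕ) < k → ¬ G.Adj x y} =
      (n - k) ^ (k - 1) * n ^ (n - k - 1) := by
  have hr : k ≤ ((⟨k, hkn⟩ : Fin n) : ℕ) := le_rfl
  generalize (⟨k, hkn⟩ : Fin n) = r at hr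
  have himage : {G : SimpleGraph (Fin n) | G.IsTree ∧
      ∀ x y : Fin n, (x : ℕ) < k → (y : ℕ) < k → ¬ G.Adj x y} = parentGraph ''
      ((Fintype.piFinset (allowedParents k r)).filter (IsParentMap r) :
        Finset (Fin n → Fin n)) := by
    ext G
    simp only [Set.mem_ofPred_eq, Set.mem_image, Finset.mem_coe, Finset.mem_filter]
    constructor
    · rintro ⟨hG, hind⟩
      obtain ⟨f, hf, rfl⟩ := hG.exists_parentGraph_eq r
      exact ⟨f, ⟨(independent_parentGraph_iff hr hf).1 hind, hf⟩, rfl⟩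
    · rintro ⟨f, ⟨hmem, hf⟩, rfl⟩
      exact ⟨hf.isTree_parentGraph, (independent_parentGraph_iff hr hf).2 hmem⟩
  have hinj : Set.InjOn parentGraph (((Fintype.piFinset (allowedParents k r)).filter
      (IsParentMap r) : Finset (Fin n → Fin n)) : Set (Fin n → Fin n)) := by
    intro f hf g hg h
    exact (Finset.mem_filter.1 hf).2.eq_of_parentGraph_eq (Finset.mem_filter.1 hg).2 h
  rw [himage, hinj.ncard_image, Set.ncard_coe_finset, ← Nat.cast_inj (R := ℚ),
    card_parentMaps_eq_det _ (by simp [allowedParents]), det_allowedParents hk hkn hr]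
end

section
/- Let 1 ≤ k < n, S = {1,…,k}, S^c = {k+1,…,n}. Let T be a tree chosen uniformly at random among all trees on vertex set {1,…,n} in which S is an independent set, and let N be the number of vertices in S^c that have no neighbor in S. Then |E[N] − (n−k)·(1 − 1/(n−k))^k·(1 − k/n)| ≤ 1. -/
open scoped Classical

/-- `NStree n k G` : the number of vertices `x ∈ Sᶜ` with no neighbor in
`S = {x | (x : ℕ) < k}` in the graph `G`. -/
noncomputable def NStree (n k : ℕ) (G : SimpleGraph (Fin n)) : ℕ :=
  Set.ncard {x : Fin n | k ≤ (x : ℕ) ∧ ∀ s : Fin n, (s : ℕ) < k → ¬ G.Adj x s}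

/-- The finite set of trees on vertex set `Fin n` in which
`S = {x | (x : ℕ) < k}` is an independent set. -/
noncomputable def indepTrees (n k : ℕ) : Finset (SimpleGraph (Fin n)) :=
  Set.Finite.toFinset (Set.toFinite {G : SimpleGraph (Fin n) | G.IsTree ∧
    ∀ x y : Fin n, (x : ℕ) < k → (y : ℕ) < k → ¬ G.Adj x y})

namespace ParentMap

variable {ι : Type*}

/-- The root `none` is reached from `v` by iterating the parent map `f`. -/
inductive ReachesRoot (f : ι → Option ι) : Option ι → Prop
  | root : ReachesRoot f none
  | step (i : ι) : ReachesRoot f (f i) → ReachesRoot f (some i)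

theorem reachesRoot_some_iff {f : ι → Option ι} {i : ι} :
    ReachesRoot f (some i) ↔ ReachesRoot f (f i) :=
  ⟨fun h => by cases h; assumption, .step i⟩

/-- Every vertex reaches the root under the parent map `f`. -/
def IsRooted (f : ι → Option ι) : Prop := ∀ v, ReachesRoot f v

/-- The graph joining every non-root vertex to its parent. -/
def graph (f : ι → Option ι) : SimpleGraph (Option ι) :=
  SimpleGraph.fromRel fun v w => ∃ i, v = some i ∧ w = f i

/-- The adjacency matrix of the parent map, with the root removed. -/
def parentMatrix [DecidableEq ι] (f : ι → Option ι) : Matrix ι ι ℝ :=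
  .of fun i j => if f i = some j then 1 else 0

theorem IsRooted.ne_some_self {f : ι → Option ι} (hf : IsRooted f) (i : ι) : f i ≠ some i := by
  have key : ∀ v, ReachesRoot f v → ∀ i, v = some i → f i ≠ some i := by
    intro v hv
    induction hv with
    | root => simp
    | step j _ ih =>
      rintro i hi h
      obtain rfl := Option.some.inj hi
      exact ih _ h h
  exact key _ (hf _) i rfl

theorem IsRooted.not_two_cycle {f : ι → Option ι} (hf : IsRooted f) {i j : ι}
    (hij : f i = some j) : f j ≠ some i := by
  have key : ∀ v, ReachesRoot f v → ∀ i j, v = some i → f i = some j → f j ≠ some i := by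
    intro v hv
    induction hv with
    | root => simp
    | step k _ ih =>
      rintro i j hi hij hji
      obtain rfl := Option.some.inj hi
      exact ih _ _ hij hji hij
  exact key _ (hf _) i j rfl hij

theorem IsRooted.graph_adj {f : ι → Option ι} (hf : IsRooted f) (i : ι) :
    (graph f).Adj (some i) (f i) :=
  ⟨(hf.ne_some_self i).symm, .inl ⟨i, rfl, rfl⟩⟩

theorem IsRooted.graph_connected {f : ι → Option ι} (hf : IsRooted f) : (graph f).Connected := by
  have key : ∀ v, (graph f).Reachable v none := by
    intro v
    induction hf v with
    | root => rfl
    | step i _ ih => exact (hf.graph_adj i).reachable.trans ih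
  exact ⟨fun v w => (key v).trans (key w).symm⟩

theorem IsRooted.graph_isTree [Finite ι] {f : ι → Option ι} (hf : IsRooted f) :
    (graph f).IsTree := by
  rw [SimpleGraph.isTree_iff_connected_and_card]
  refine ⟨hf.graph_connected, le_antisymm ?_ hf.graph_connected.card_vert_le_card_edgeSet_add_one⟩
  rw [Finite.card_option, add_le_add_iff_right]
  refine Nat.card_le_card_of_surjective
    (fun i => (⟨s(some i, f i), hf.graph_adj i⟩ : (graph f).edgeSet)) ?_
  rintro ⟨e, he⟩
  induction e with | _ v w
  obtain ⟨i, hv, hw⟩ | ⟨i, hw, hv⟩ := he.2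
  · exact ⟨i, Subtype.ext (congrArg₂ (s(·, ·)) hv.symm hw.symm)⟩
  · exact ⟨i, Subtype.ext (Sym2.eq_swap.trans (congrArg₂ (s(·, ·)) hv.symm hw.symm))⟩

theorem IsRooted.graph_inj {f g : ι → Option ι} (hf : IsRooted f)
    (h : graph f = graph g) : f = g := by
  have key : ∀ v, ReachesRoot f v → ∀ i, v = some i → f i = g i := by
    intro v hv
    induction hv with
    | root => simp
    | step j _ ih =>
      rintro i hi
      obtain rfl := Option.some.inj hi
      have hadj := hf.graph_adj j
      rw [h] at hadj
      obtain ⟨_, ⟨i, hi, hfg⟩ | ⟨i, hi, hgi⟩⟩ := hadj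
      · rw [Option.some.inj hi, ← hfg, ← Option.some.inj hi]
      · exact absurd ((ih i hi).trans hgi.symm) (hf.not_two_cycle hi)
  exact funext fun i => key _ (hf _) i rfl

theorem exists_isRooted_graph_eq {G : SimpleGraph (Option ι)} (hG : G.IsTree) :
    ∃ f, IsRooted f ∧ graph f = G := by
  have step : ∀ i : ι, ∃ w, G.Adj (some i) w ∧ G.dist w none < G.dist (some i) none := by
    intro i
    obtain ⟨p, hp⟩ := hG.connected.exists_walk_length_eq_dist (some i) none
    cases p with
    | cons h q => exact ⟨_, h, by rw [← hp]; exact Nat.lt_succ_of_le (SimpleGraph.dist_le q)⟩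
  choose f hadj hlt using step
  have hf : IsRooted f := by
    have key : ∀ d v, G.dist v none ≤ d → ReachesRoot f v := by
      intro d
      induction d with
      | zero =>
        rintro (_ | i) h
        · exact .root
        · exact absurd (hlt i) (by omega)
      | succ d ih =>
        rintro (_ | i) h
        · exact .root
        · exact .step i (ih _ (by have := hlt i; omega))
    exact fun v => key _ v le_rfl
  have hle : graph f ≤ G := by
    rintro v w ⟨_, ⟨i, rfl, rfl⟩ | ⟨i, rfl, rfl⟩⟩
    exacts [hadj i, (hadj i).symm]
  exact ⟨f, hf, le_antisymm hle
    ((SimpleGraph.isTree_iff_minimal_connected.1 hG).2 hf.graph_connected hle)⟩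

variable [Fintype ι] [DecidableEq ι]

theorem IsRooted.isNilpotent_parentMatrix {f : ι → Option ι} (hf : IsRooted f) :
    IsNilpotent (parentMatrix f) := by
  have key : ∀ v, ReachesRoot f v → ∃ d, ∀ N ≥ d, ∀ i, v = some i → ∀ j,
      (parentMatrix f ^ N) i j = 0 := by
    intro v hv
    induction hv with
    | root => simp
    | step k _ ih =>
      obtain ⟨d, hd⟩ := ih
      refine ⟨d + 1, fun N hN i hi j => ?_⟩
      obtain rfl := Option.some.inj hi
      obtain ⟨N, rfl⟩ : ∃ M, N = M + 1 := ⟨N - 1, by omega⟩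
      rw [pow_succ', Matrix.mul_apply]
      refine Finset.sum_eq_zero fun l _ => ?_
      by_cases hl : f k = some l
      · rw [hd N (by omega) l hl j, mul_zero]
      · simp [parentMatrix, hl]
  choose d hd using fun i : ι => key _ (hf (some i))
  refine ⟨∑ i, d i, ?_⟩
  ext i j
  exact hd i _ (Finset.single_le_sum (fun _ _ => Nat.zero_le _) (Finset.mem_univ i)) i rfl j

theorem det_one_sub_parentMatrix (f : ι → Option ι) :
    (1 - parentMatrix f).det = if IsRooted f then 1 else 0 := by
  split_ifs with hf
  · have h := Matrix.isNilpotent_charpoly_sub_pow_of_isNilpotent hf.isNilpotent_parentMatrix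
    have h := sub_eq_zero.1 h.eq_zero
    simpa [Matrix.eval_charpoly] using congrArg (Polynomial.eval 1) h
  · rw [← Matrix.exists_mulVec_eq_zero_iff]
    refine ⟨fun i => if ReachesRoot f (some i) then 0 else 1, fun h => hf ?_, ?_⟩
    · rintro (_ | i)
      · exact .root
      · by_contra hi
        simpa [hi] using congrFun h i
    · ext i
      rw [Matrix.sub_mulVec, Matrix.one_mulVec, Pi.sub_apply, Pi.zero_apply, sub_eq_zero,
        reachesRoot_some_iff]
      simp only [Matrix.mulVec, dotProduct, parentMatrix, Matrix.of_apply]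
      rcases hi : f i with _ | j
      · simp [ReachesRoot.root]
      · rw [Finset.sum_eq_single j] <;> simp +contextual [eq_comm]

end ParentMap

namespace SimpleGraph

open ParentMap

/-- The **matrix-tree theorem**: spanning trees are counted by the Laplacian with one row and
column removed. -/
theorem card_isTree_le_eq_det {ι : Type*} [Fintype ι] [DecidableEq ι] (H : SimpleGraph (Option ι)) :
    ({G : SimpleGraph (Option ι) | G.IsTree ∧ G ≤ H}.ncard : ℝ) =
      ((H.lapMatrix ℝ).submatrix some some).det := by
  have hrow : (H.lapMatrix ℝ).submatrix some some = fun i => ∑ u ∈ H.neighborFinset (some i),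
      fun j : ι => (if i = j then 1 else 0) - (if u = some j then (1 : ℝ) else 0) := by
    ext i j
    simp [lapMatrix, degMatrix, Matrix.diagonal_apply, Finset.sum_apply, adjMatrix_apply]
  have hdet : ∀ f : ι → Option ι, Matrix.detRowAlternating (R := ℝ)
      (fun i j => (if i = j then 1 else 0) - (if f i = some j then (1 : ℝ) else 0)) =
      if IsRooted f then 1 else 0 := by
    intro f
    rw [← det_one_sub_parentMatrix]
    congr 1
  have hexp := (Matrix.detRowAlternating (n := ι) (R := ℝ)).toMultilinearMap.map_sum_finset
    (fun i (u : Option ι) => fun j : ι =>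
      (if i = j then 1 else 0) - (if u = some j then (1 : ℝ) else 0))
    (fun i => H.neighborFinset (some i))
  rw [hrow]
  refine Eq.trans ?_ hexp.symm
  simp only [AlternatingMap.coe_multilinearMap, hdet]
  rw [Finset.sum_boole, Set.ncard_eq_toFinset_card']
  norm_cast
  symm
  refine Finset.card_bij (fun f _ => graph f) ?_ ?_ ?_
  · intro f hf
    simp only [Finset.mem_filter, Fintype.mem_piFinset, mem_neighborFinset,
      Set.mem_toFinset] at hf ⊢
    refine ⟨hf.2.graph_isTree, ?_⟩
    rintro v w ⟨_, ⟨i, rfl, rfl⟩ | ⟨i, rfl, rfl⟩⟩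
    exacts [hf.1 i, (hf.1 i).symm]
  · intro f hf g _ h
    exact (Finset.mem_filter.1 hf).2.graph_inj h
  · intro G hG
    obtain ⟨hG, hle⟩ := Set.mem_toFinset.1 hG
    obtain ⟨f, hf, rfl⟩ := exists_isRooted_graph_eq hG
    refine ⟨f, ?_, rfl⟩
    simp only [Finset.mem_filter, Fintype.mem_piFinset, mem_neighborFinset]
    exact ⟨fun i => hle (hf.graph_adj i), hf⟩


/-- The graph in which two distinct vertices are adjacent unless both lie in `S`. -/
def outsideGraph {V : Type*} (S : Set V) : SimpleGraph V where
  Adj v w := v ≠ w ∧ ¬(v ∈ S ∧ w ∈ S)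
  symm := ⟨fun _ _ h => ⟨h.1.symm, fun h' => h.2 h'.symm⟩⟩
  loopless := ⟨fun _ h => h.1 rfl⟩

theorem le_outsideGraph_iff {V : Type*} {S : Set V} {G : SimpleGraph V} :
    G ≤ outsideGraph S ↔ ∀ x ∈ S, ∀ y ∈ S, ¬G.Adj x y :=
  ⟨fun h _ hx _ hy hxy => (h hxy).2 ⟨hx, hy⟩,
    fun h _ _ hxy => ⟨hxy.ne, fun h' => h _ h'.1 _ h'.2 hxy⟩⟩

theorem lapMatrix_outsideGraph_submatrix {α β : Type*} [Fintype α] [Fintype β] :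
    ((outsideGraph (Set.range fun a : α => (some (.inl a) : Option (α ⊕ β)))).lapMatrix
      ℝ).submatrix some some =
      Matrix.fromBlocks ((Fintype.card β + 1 : ℝ) • 1) (.of fun _ _ => -1) (.of fun _ _ => -1)
        ((Fintype.card α + Fintype.card β + 1 : ℝ) • 1 - .of fun _ _ => 1) := by
  have hα (i : α) : (outsideGraph (Set.range fun a : α =>
      (some (.inl a) : Option (α ⊕ β)))).degree (some (.inl i)) = (Fintype.card β + 1 : ℝ) := by
    rw [degree_eq_sum_if_adj, Fintype.sum_option, Fintype.sum_sum_type]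
    simp [outsideGraph, add_comm]
  have hβ (i : β) : (outsideGraph (Set.range fun a : α =>
      (some (.inl a) : Option (α ⊕ β)))).degree (some (.inr i)) =
      (Fintype.card α + Fintype.card β : ℝ) := by
    rw [degree_eq_sum_if_adj, Fintype.sum_option, Fintype.sum_sum_type]
    have hite (j : β) : (if i = j then (0 : ℝ) else 1) = 1 - if i = j then 1 else 0 := by
      split_ifs <;> simp
    simp [outsideGraph, hite]
    ring
  have hadj (x y : Option (α ⊕ β)) : (outsideGraph (Set.range fun a : α =>
      (some (.inl a) : Option (α ⊕ β)))).Adj x y ↔ x ≠ y ∧ ¬((∃ a, some (.inl a) = x) ∧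
        ∃ a, some (.inl a) = y) := Iff.rfl
  ext (i | i) (j | j)
  all_goals
    simp only [lapMatrix, degMatrix, Matrix.submatrix_apply, Matrix.sub_apply,
      Matrix.diagonal_apply, adjMatrix_apply, hα, hβ, hadj]
  on_goal 4 => rcases eq_or_ne i j with rfl | hij
  all_goals simp [Matrix.one_apply, *]

theorem det_outsideGraph {α β : Type*} [Fintype α] [Fintype β] :
    (Fintype.card β + 1 : ℝ) *
      (Matrix.fromBlocks ((Fintype.card β + 1 : ℝ) • (1 : Matrix α α ℝ)) (.of fun _ _ => -1)
        (.of fun _ _ => -1)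
        ((Fintype.card α + Fintype.card β + 1 : ℝ) • (1 : Matrix β β ℝ) - .of fun _ _ => 1)).det =
      (Fintype.card β + 1 : ℝ) ^ Fintype.card α *
        (Fintype.card α + Fintype.card β + 1 : ℝ) ^ Fintype.card β := by
  have hm : (Fintype.card β + 1 : ℝ) ≠ 0 := by positivity
  have hn : (Fintype.card α + Fintype.card β + 1 : ℝ) ≠ 0 := by positivity
  let : Invertible ((Fintype.card β + 1 : ℝ) • (1 : Matrix α α ℝ)) :=
    ⟨(Fintype.card β + 1 : ℝ)⁻¹ • 1, by simp [hm], by simp [hm]⟩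
  have hinv : ⅟((Fintype.card β + 1 : ℝ) • (1 : Matrix α α ℝ)) =
    (Fintype.card β + 1 : ℝ)⁻¹ • 1 := rfl
  have hschur : ((Fintype.card α + Fintype.card β + 1 : ℝ) • (1 : Matrix β β ℝ) - .of fun _ _ => 1) -
      (.of fun _ _ => -1 : Matrix β α ℝ) * ((Fintype.card β + 1 : ℝ)⁻¹ • (1 : Matrix α α ℝ)) *
        (.of fun _ _ => -1 : Matrix α β ℝ) =
      (Fintype.card α + Fintype.card β + 1 : ℝ) •
        (1 + Matrix.replicateCol Unit (fun _ : β => -(Fintype.card β + 1 : ℝ)⁻¹) *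
          Matrix.replicateRow Unit (fun _ : β => (1 : ℝ))) := by
    ext i j
    rcases eq_or_ne i j with rfl | hij
    · simp [Matrix.mul_apply]
      field_simp
      ring
    · simp [Matrix.mul_apply, hij]
      field_simp
      ring
  rw [Matrix.det_fromBlocks₁₁, hinv, hschur, Matrix.det_smul, Matrix.det_smul,
    Matrix.det_one_add_replicateCol_mul_replicateRow]
  simp [dotProduct]
  field_simp
  ring

/-- The trees in which `S` is an independent set. -/
def treesIndepOn {V : Type*} (S : Set V) : Set (SimpleGraph V) :=
  {G | G.IsTree ∧ G ≤ outsideGraph S}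

theorem card_treesIndepOn_range_inl (α β : Type*) [Fintype α] [Fintype β] :
    (Fintype.card β + 1 : ℝ) *
        (treesIndepOn (Set.range fun a : α => (some (.inl a) : Option (α ⊕ β)))).ncard =
      (Fintype.card β + 1 : ℝ) ^ Fintype.card α *
        (Fintype.card α + Fintype.card β + 1 : ℝ) ^ Fintype.card β := by
  rw [treesIndepOn, card_isTree_le_eq_det, lapMatrix_outsideGraph_submatrix, det_outsideGraph]

theorem card_treesIndepOn_image {V W : Type*} (e : V ≃ W) (S : Set V) :
    (treesIndepOn (e '' S)).ncard = (treesIndepOn S).ncard := by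
  symm
  refine Set.ncard_congr' (e.simpleGraph.subtypeEquiv fun G => ?_)
  have hiso : (e.simpleGraph G).IsTree ↔ G.IsTree :=
    (Iso.comap e.symm G).isTree_iff
  simp only [treesIndepOn, Set.mem_ofPred_eq, hiso, le_outsideGraph_iff, Set.forall_mem_image]
  simp [Equiv.simpleGraph]

theorem card_treesIndepOn {V : Type*} [Finite V] (S : Set V) {k m : ℕ} (hk : S.ncard = k)
    (hm : Sᶜ.ncard = m + 1) :
    (m + 1 : ℝ) * (treesIndepOn S).ncard = (m + 1 : ℝ) ^ k * (k + m + 1 : ℝ) ^ m := by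
  let e₁ : S ≃ Fin k := Finite.equivFinOfCardEq hk
  let e₂ : (Sᶜ : Set V) ≃ Fin (m + 1) := Finite.equivFinOfCardEq hm
  let e : V ≃ Option (Fin k ⊕ Fin m) :=
    (Equiv.Set.sumCompl S).symm.trans <| (Equiv.sumCongr e₁ (e₂.trans (finSuccEquiv m))).trans <|
      (Equiv.sumCongr (.refl _) (Equiv.optionEquivSumPUnit _)).trans <|
      (Equiv.sumAssoc _ _ _).symm.trans (Equiv.optionEquivSumPUnit.{0} _).symm
  have he : e '' S = Set.range fun a => some (.inl a) := by
    ext x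
    constructor
    · rintro ⟨v, hv, rfl⟩
      exact ⟨e₁ ⟨v, hv⟩, by simp [e, Equiv.Set.sumCompl_symm_apply_of_mem hv]⟩
    · rintro ⟨a, rfl⟩
      exact ⟨e₁.symm a, (e₁.symm a).2, by simp [e]⟩
  rw [← card_treesIndepOn_image e, he]
  simpa using card_treesIndepOn_range_inl (Fin k) (Fin m)

theorem mem_treesIndepOn_insert_iff {V : Type*} {S : Set V} {x : V} {G : SimpleGraph V} :
    G ∈ treesIndepOn (insert x S) ↔ G ∈ treesIndepOn S ∧ ∀ s ∈ S, ¬G.Adj x s := by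
  simp only [treesIndepOn, Set.mem_ofPred_eq, le_outsideGraph_iff, Set.forall_mem_insert,
    G.irrefl, not_false_eq_true, true_and]
  have := fun s => G.adj_comm s x
  grind

theorem treesIndepOn_univ (V : Type*) [Nontrivial V] :
    treesIndepOn (Set.univ : Set V) = ∅ := by
  refine Set.eq_empty_of_forall_notMem fun G hG => ?_
  obtain ⟨v⟩ := hG.1.connected.nonempty
  obtain ⟨w, hw⟩ := hG.1.connected.preconnected.exists_adj_of_nontrivial v
  exact le_outsideGraph_iff.1 hG.2 v trivial w trivial hw

theorem card_treesIndepOn_insert {V : Type*} [Finite V] {S : Set V} {x : V} (hx : x ∉ S)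
    {k m : ℕ} (hk0 : 1 ≤ k) (hk : S.ncard = k) (hm : Sᶜ.ncard = m + 1) :
    ((treesIndepOn (insert x S)).ncard : ℝ) * (k + m + 1) = (m : ℝ) ^ k * (k + m + 1 : ℝ) ^ m := by
  have hcard : (insert x S).ncard = k + 1 := by rw [Set.ncard_insert_of_notMem hx, hk]
  have hcompl : (insert x S)ᶜ.ncard = m := by
    have h₁ := Set.ncard_add_ncard_compl S
    have h₂ := Set.ncard_add_ncard_compl (insert x S)
    omega
  obtain _ | m := m
  · rw [Set.ncard_eq_zero, Set.compl_empty_iff] at hcompl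
    obtain ⟨y, hy⟩ : S.Nonempty := Set.nonempty_of_ncard_ne_zero (by omega)
    have : Nontrivial V := ⟨x, y, fun h => hx (h ▸ hy)⟩
    rw [hcompl, treesIndepOn_univ]
    simp [show k ≠ 0 by omega]
  · have h := card_treesIndepOn _ hcard hcompl
    have hm0 : (m + 1 : ℝ) ≠ 0 := by positivity
    push_cast at h ⊢
    apply mul_left_cancel₀ hm0
    rw [← mul_assoc, h]
    ring

end SimpleGraph

open SimpleGraph

theorem coe_indepTrees (n k : ℕ) :
    (indepTrees n k : Set (SimpleGraph (Fin n))) = treesIndepOn {x : Fin n | (x : ℕ) < k} := by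
  ext G
  simp only [indepTrees, treesIndepOn, le_outsideGraph_iff, Set.Finite.coe_toFinset,
    Set.mem_ofPred_eq]
  grind

theorem sum_NStree (n k : ℕ) :
    ∑ G ∈ indepTrees n k, NStree n k G =
      ∑ x ∈ Finset.univ.filter fun x : Fin n => k ≤ (x : ℕ),
        (treesIndepOn (insert x {y : Fin n | (y : ℕ) < k})).ncard := by
  have h := Finset.sum_card_bipartiteAbove_eq_sum_card_bipartiteBelow
    (s := indepTrees n k) (t := Finset.univ.filter fun x : Fin n => k ≤ (x : ℕ))
    fun G x => ∀ s : Fin n, (s : ℕ) < k → ¬G.Adj x s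
  convert h using 2 with G _ x _
  · rw [NStree, ← Set.ncard_coe_finset]
    congr 1
    ext x
    simp [Finset.bipartiteAbove]
  · rw [← Set.ncard_coe_finset]
    congr 1
    ext G
    rw [mem_treesIndepOn_insert_iff, ← coe_indepTrees]
    simp [Finset.bipartiteBelow]

theorem expected_not_connected_random_tree (n k : ℕ) (hk : 1 ≤ k) (hkn : k < n) :
    |(∑ G ∈ indepTrees n k, (NStree n k G : ℝ)) / ((indepTrees n k).card : ℝ) -
      ((n : ℝ) - k) * (1 - 1 / ((n : ℝ) - k)) ^ k * (1 - (k : ℝ) / n)| ≤ 1 := by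
  obtain ⟨m, rfl⟩ : ∃ m, n = k + m + 1 := ⟨n - k - 1, by omega⟩
  set S : Set (Fin (k + m + 1)) := {x | (x : ℕ) < k} with hS
  have hk' : S.ncard = k := by
    rw [show S = (Finset.univ.filter fun x : Fin (k + m + 1) => (x : ℕ) < k : Finset _) by simp [hS],
      Set.ncard_coe_finset, Fin.card_filter_val_lt]
    omega
  have hm : Sᶜ.ncard = m + 1 := by
    have := Set.ncard_add_ncard_compl S
    simp only [Nat.card_eq_fintype_card, Fintype.card_fin] at this
    omega
  have hcompl : (Finset.univ.filter fun x : Fin (k + m + 1) => k ≤ (x : ℕ)).card = m + 1 := by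
    rw [← hm, ← Set.ncard_coe_finset]
    congr 1
    ext x
    simp [hS]
  have hcard : (m + 1 : ℝ) * (indepTrees (k + m + 1) k).card =
      (m + 1 : ℝ) ^ k * (k + m + 1 : ℝ) ^ m := by
    rw [← Set.ncard_coe_finset, coe_indepTrees, card_treesIndepOn S hk' hm]
  have hn0 : (k + m + 1 : ℝ) ≠ 0 := by positivity
  have hm0 : (m + 1 : ℝ) ≠ 0 := by positivity
  have hsum : ∑ G ∈ indepTrees (k + m + 1) k, (NStree (k + m + 1) k G : ℝ) =
      (m + 1) * ((m : ℝ) ^ k * (k + m + 1 : ℝ) ^ m / (k + m + 1)) := by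
    have hx : ∀ x ∈ Finset.univ.filter fun x : Fin (k + m + 1) => k ≤ (x : ℕ),
        ((treesIndepOn (insert x S)).ncard : ℝ) =
          (m : ℝ) ^ k * (k + m + 1 : ℝ) ^ m / (k + m + 1) := fun x hx =>
      eq_div_of_mul_eq hn0 (card_treesIndepOn_insert (by simpa [hS] using hx) hk hk' hm)
    rw [← Nat.cast_sum, sum_NStree, Nat.cast_sum, Finset.sum_congr rfl hx, Finset.sum_const,
      hcompl, nsmul_eq_mul]
    push_cast
    rfl
  rw [hsum, eq_div_of_mul_eq hm0 ((mul_comm _ _).trans hcard)]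
  have hsub : ((k + m + 1 : ℕ) : ℝ) - k = m + 1 := by push_cast; ring
  have hfrac : 1 - 1 / (m + 1 : ℝ) = m / (m + 1) := by field_simp; ring
  have hfrac' : 1 - (k : ℝ) / ((k + m + 1 : ℕ) : ℝ) = (m + 1) / (k + m + 1) := by
    push_cast; field_simp; ring
  rw [hsub, hfrac, hfrac', div_pow]
  refine (le_of_eq ?_).trans zero_le_one
  rw [abs_eq_zero, sub_eq_zero]
  field_simp
end

section
/- For each n, let k_n be an integer with 1 ≤ k_n < n such that n − k_n → ∞ as n → ∞, and set S_n = {1,…,k_n}, S_n^c = {k_n+1,…,n}. Let f be a uniformly random function from {1,…,n} to {1,…,n} conditioned on f(S_n) ⊆ S_n^c, and let c(f) be its number of cycles. Then for every t > 0 and every ε > 0 there exists N such that for all n ≥ N, P(c(f) > (1+t)·log(n − k_n)) ≤ (1+ε)·exp(−(t²/(2+t))·log(n − k_n)/4), where log denotes the natural logarithm. -/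
open scoped Classical

/-- The core of a self-map: the set of points lying on a cycle,
i.e. `x` with `f^[j] x = x` for some `j ≥ 1`. -/
def inCore {V : Type*} (f : V → V) (x : V) : Prop := ∃ j ≥ 1, f^[j] x = x

/-- The number of cycles of a self-map: the number of distinct forward orbits
of points of the core (each cycle is the forward orbit of any of its points). -/
noncomputable def cycleCount {V : Type*} (f : V → V) : ℕ :=
  Set.ncard ((fun x => {y | ∃ j : ℕ, f^[j] x = y}) '' {x | inCore f x})

/-- The finite set of functions `f : Fin n → Fin n` with `f(S) ⊆ Sᶜ`,
where `S = {x | (x : ℕ) < k}`. -/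
noncomputable def condMaps (n k : ℕ) : Finset (Fin n → Fin n) :=
  Finset.univ.filter (fun f => ∀ x : Fin n, (x : ℕ) < k → k ≤ (f x : ℕ))

/-- Probability of an event under the uniform distribution on `condMaps n k`. -/
noncomputable def condPr (n k : ℕ) (P : (Fin n → Fin n) → Prop) : ℝ :=
  (((condMaps n k).filter P).card : ℝ) / (condMaps n k).card

/-- The cycles of a self-map, as the forward orbits of its core points. -/
def cycleSet {V : Type*} (f : V → V) : Set (Set V) :=
  (fun x => {y | ∃ j : ℕ, f^[j] x = y}) '' {x | inCore f x}

theorem cycleSet_eq_orbit {V : Type*} {f : V → V} {C : Set V} (hC : C ∈ cycleSet f)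
    {x : V} (hx : x ∈ C) : C = {y | ∃ j : ℕ, f^[j] x = y} := by
  obtain ⟨p, ⟨j₀, hj₀, hp⟩, rfl⟩ := hC
  obtain ⟨i, rfl⟩ := hx
  have hback : f^[j₀ * i - i] (f^[i] p) = p := by
    rw [← Function.iterate_add_apply, Nat.sub_add_cancel (Nat.le_mul_of_pos_left i hj₀)]
    exact Function.IsPeriodicPt.mul_const (show Function.IsPeriodicPt f j₀ p from hp) i
  ext y
  constructor
  · rintro ⟨j, rfl⟩
    exact ⟨j + (j₀ * i - i), by rw [Function.iterate_add_apply, hback]⟩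
  · rintro ⟨j, rfl⟩
    exact ⟨j + i, by rw [Function.iterate_add_apply]⟩

theorem cycleSet_nonempty {V : Type*} {f : V → V} {C : Set V} (hC : C ∈ cycleSet f) :
    C.Nonempty := by
  obtain ⟨p, -, rfl⟩ := hC
  exact ⟨p, 0, rfl⟩

theorem iterate_mem_of_mem_cycleSet {V : Type*} {f : V → V} {C : Set V} (hC : C ∈ cycleSet f)
    {x : V} (hx : x ∈ C) (j : ℕ) : f^[j] x ∈ C := by
  rw [cycleSet_eq_orbit hC hx]
  exact ⟨j, rfl⟩

theorem exists_iterate_inCore {A : Type*} [Finite A] (g : A → A) (a : A) :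
    ∃ i, inCore g (g^[i] a) := by
  obtain ⟨i, j, hij, h⟩ := Finite.exists_ne_map_eq_of_infinite (fun i : ℕ => g^[i] a)
  wlog hlt : i < j generalizing i j
  · exact this j i hij.symm h.symm (by omega)
  refine ⟨i, j - i, by omega, ?_⟩
  rw [← Function.iterate_add_apply, Nat.sub_add_cancel hlt.le]
  exact h.symm

/-- If `g` moves every point along the `f`-orbit of its image under `ι`, then `g` has at least
as many cycles as there are cycles of `f` meeting the range of `ι`. -/
theorem ncard_cycleSet_meeting_le {V A : Type*} [Finite A] {f : V → V} {g : A → A}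
    (ι : A → V) (h : ∀ a, ∃ j, f^[j] (ι a) = ι (g a)) :
    {C ∈ cycleSet f | ∃ a, ι a ∈ C}.ncard ≤ cycleCount g := by
  have key : ∀ C : Set V, ∃ D : Set A, C ∈ {C ∈ cycleSet f | ∃ a, ι a ∈ C} →
      D ∈ cycleSet g ∧ ∀ d ∈ D, ι d ∈ C := by
    intro C
    by_cases hC : C ∈ {C ∈ cycleSet f | ∃ a, ι a ∈ C}
    · obtain ⟨hC, a, ha⟩ := hC
      have stay : ∀ i, ι (g^[i] a) ∈ C := by
        intro i
        induction i with
        | zero => exact ha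
        | succ i ih =>
          obtain ⟨j, hj⟩ := h (g^[i] a)
          rw [Function.iterate_succ_apply', ← hj]
          exact iterate_mem_of_mem_cycleSet hC ih j
      obtain ⟨i, hi⟩ := exists_iterate_inCore g a
      refine ⟨_, fun _ => ⟨⟨_, hi, rfl⟩, ?_⟩⟩
      rintro d ⟨j, rfl⟩
      rw [← Function.iterate_add_apply]
      exact stay _
    · exact ⟨∅, fun h => absurd h hC⟩
  choose F hF using key
  refine Set.ncard_le_ncard_of_injOn F (fun C hC => (hF C hC).1) ?_ (Set.toFinite _)
  intro C hC C' hC' hCC'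
  obtain ⟨d, hd⟩ := cycleSet_nonempty (hF C hC).1
  rw [cycleSet_eq_orbit hC.1 ((hF C hC).2 d hd),
    cycleSet_eq_orbit hC'.1 ((hF C' hC').2 d (hCC' ▸ hd))]

/-- The map induced by `h : B → A` after deleting `a` from `A` and `b` from `B`: points sent
to `a` are redirected to `h b`. -/
noncomputable def contract {A B : Type*} (h : B → A) (a : A) (b : B)
    (hab : ∀ y, y ≠ b → h y = a → h b ≠ a) (y : {y // y ≠ b}) : {x // x ≠ a} :=
  if hy : h y = a then ⟨h b, hab y y.2 hy⟩ else ⟨h y, hy⟩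

theorem cycleCount_le_contract {A B : Type*} [Finite A] (h : B → A) (a : A) (b : B)
    (hab : ∀ y, y ≠ b → h y = a → h b ≠ a) (e : A ≃ B) (he : e a = b)
    (e' : {x // x ≠ a} ≃ {y // y ≠ b}) (hee' : ∀ x, (e' x : B) = e x) :
    cycleCount (h ∘ e) ≤ cycleCount (contract h a b hab ∘ e') + if h b = a then 1 else 0 := by
  have hle := ncard_cycleSet_meeting_le (f := h ∘ e) (g := contract h a b hab ∘ e')
    Subtype.val (by
      intro x
      by_cases hx : h (e x) = a
      · refine ⟨2, ?_⟩
        simp [contract, hee', hx, he]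
      · refine ⟨1, ?_⟩
        simp [contract, hee', hx])
  set M := {C ∈ cycleSet (h ∘ e) | ∃ x : {x // x ≠ a}, (x : A) ∈ C} with hM
  have hmiss : ∀ C ∈ cycleSet (h ∘ e), C ∉ M → C = {a} := by
    intro C hC hCM
    have hall : ∀ x ∈ C, x = a := fun x hx => by
      by_contra hxa
      exact hCM ⟨hC, ⟨x, hxa⟩, hx⟩
    exact Set.eq_singleton_iff_nonempty_unique_mem.2 ⟨cycleSet_nonempty hC, hall⟩
  change (cycleSet (h ∘ e)).ncard ≤ _
  split_ifs with hb
  · have hsub : cycleSet (h ∘ e) ⊆ insert {a} M := by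
      intro C hC
      by_cases hCM : C ∈ M
      · exact Or.inr hCM
      · exact Or.inl (hmiss C hC hCM)
    calc _ ≤ (insert {a} M).ncard := Set.ncard_le_ncard hsub (Set.toFinite _)
      _ ≤ M.ncard + 1 := Set.ncard_insert_le _ _
      _ ≤ _ := by omega
  · have hsub : cycleSet (h ∘ e) ⊆ M := by
      intro C hC
      by_contra hCM
      have hCa := hmiss C hC hCM
      have := iterate_mem_of_mem_cycleSet hC (x := a) (by simp [hCa]) 1
      rw [hCa] at this
      exact hb (by simpa [he] using this)
    exact (Set.ncard_le_ncard hsub (Set.toFinite _)).trans hle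

/-- The generating function of the number of cycles of `h ∘ e`, over all bijections `e`, is
largest when `h` is itself a bijection. -/
theorem sum_pow_cycleCount_comp_equiv_le (z : ℝ) (hz : 1 ≤ z) (m : ℕ) :
    ∀ (A B : Type) [Fintype A] [Fintype B] [DecidableEq A] [DecidableEq B] (h : B → A),
      Fintype.card A = m → Fintype.card B = m →
      ∑ e : A ≃ B, z ^ cycleCount (h ∘ e) ≤ ∏ i ∈ Finset.range m, (z + i) := by
  induction m with
  | zero =>
    intro A B _ _ _ _ h hA hB
    have := Fintype.card_eq_zero_iff.1 hA
    have := Fintype.card_eq_zero_iff.1 hB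
    have hc : ∀ e : A ≃ B, cycleCount (h ∘ e) = 0 := by
      intro e
      simp [cycleCount, Set.eq_empty_of_isEmpty]
    simp only [hc, pow_zero, Finset.sum_const, nsmul_eq_mul, mul_one, Finset.range_zero,
      Finset.prod_empty]
    exact_mod_cast Finset.card_le_one_of_subsingleton _
  | succ m ih =>
    intro A B _ _ _ _ h hA hB
    have : Nonempty A := Fintype.card_pos_iff.1 (by omega)
    obtain ⟨a, ha⟩ := Fintype.exists_card_fiber_le_of_card_le_mul (f := h) (n := 1)
      (by omega)
    have huniq : ∀ y b, h y = a → h b = a → y = b := fun y b hy hb =>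
      Finset.card_le_one.1 ha y (by simpa using hy) b (by simpa using hb)
    set P := ∏ i ∈ Finset.range m, (z + i) with hP
    have hP0 : 0 ≤ P := Finset.prod_nonneg fun i _ => by positivity
    have hfib : ∀ b : B, ∑ e : A ≃ B with e a = b, z ^ cycleCount (h ∘ e) ≤
        P * (if h b = a then z else 1) := by
      intro b
      have hab : ∀ y, y ≠ b → h y = a → h b ≠ a := fun y hyb hy hb => hyb (huniq y b hy hb)
      have hdel : ∀ e : A ≃ B, ∃ e' : {x // x ≠ a} ≃ {y // y ≠ b},
          e a = b → ∀ x, (e' x : B) = e x := by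
        intro e
        by_cases he : e a = b
        · exact ⟨e.subtypeEquiv fun x => by rw [← he, ne_eq, ne_eq, e.apply_eq_iff_eq],
            fun _ x => rfl⟩
        · have : Fintype.card {x // x ≠ a} = Fintype.card {y // y ≠ b} := by
            simp [Fintype.card_subtype_compl, hA, hB]
          exact ⟨Fintype.equivOfCardEq this, fun h => absurd h he⟩
      choose D hD using hdel
      have hinj : Set.InjOn D {e : A ≃ B | e a = b} := by
        intro e he e₂ he₂ hee
        ext x
        by_cases hx : x = a
        · rw [hx, he, he₂]
        · rw [← hD e he ⟨x, hx⟩, hee, hD e₂ he₂ ⟨x, hx⟩]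
      calc ∑ e : A ≃ B with e a = b, z ^ cycleCount (h ∘ e)
          ≤ ∑ e : A ≃ B with e a = b,
              z ^ cycleCount (contract h a b hab ∘ D e) * (if h b = a then z else 1) := by
            refine Finset.sum_le_sum fun e he => ?_
            have he : e a = b := by simpa using he
            refine (pow_le_pow_right₀ hz
              (cycleCount_le_contract h a b hab e he (D e) (hD e he))).trans_eq ?_
            split_ifs <;> simp [pow_succ]
        _ = (∑ e' ∈ (Finset.univ.filter fun e : A ≃ B => e a = b).image D,
              z ^ cycleCount (contract h a b hab ∘ e')) * (if h b = a then z else 1) := by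
            rw [Finset.sum_image (by simpa using hinj), Finset.sum_mul]
        _ ≤ P * (if h b = a then z else 1) := by
            refine mul_le_mul_of_nonneg_right ?_ (by split_ifs <;> positivity)
            refine (Finset.sum_le_sum_of_subset_of_nonneg (Finset.subset_univ _)
              fun _ _ _ => by positivity).trans ?_
            exact ih _ _ _ (by simp [Fintype.card_subtype_compl, hA])
              (by simp [Fintype.card_subtype_compl, hB])
    calc ∑ e : A ≃ B, z ^ cycleCount (h ∘ e)
        = ∑ b : B, ∑ e : A ≃ B with e a = b, z ^ cycleCount (h ∘ e) :=
          (Finset.sum_fiberwise _ _ _).symm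
      _ ≤ ∑ b : B, P * (if h b = a then z else 1) := Finset.sum_le_sum fun b _ => hfib b
      _ = P * ∑ b : B, (1 + if h b = a then z - 1 else 0) := by
          rw [Finset.mul_sum]
          refine Finset.sum_congr rfl fun b _ => ?_
          split_ifs <;> ring
      _ ≤ P * (z + m) := by
          refine mul_le_mul_of_nonneg_left ?_ hP0
          rw [Finset.sum_add_distrib, ← Finset.sum_filter]
          simp only [Finset.sum_const, Finset.card_univ, hB, nsmul_eq_mul, mul_one]
          have : ((Finset.univ.filter fun b => h b = a).card : ℝ) ≤ 1 := by
            exact_mod_cast ha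
          push_cast
          nlinarith
      _ = ∏ i ∈ Finset.range (m + 1), (z + i) := by rw [Finset.prod_range_succ]

/-- The first-return map to `{x | k ≤ x}` of a map sending `{x | x < k}` into `{x | k ≤ x}`. -/
noncomputable def firstReturn {n k : ℕ} (f : Fin n → Fin n)
    (hf : ∀ x : Fin n, (x : ℕ) < k → k ≤ (f x : ℕ)) (x : {x : Fin n // k ≤ (x : ℕ)}) :
    {x : Fin n // k ≤ (x : ℕ)} :=
  if hx : k ≤ (f x : ℕ) then ⟨f x, hx⟩ else ⟨f (f x), hf _ (not_le.1 hx)⟩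

theorem cycleCount_comp_ofSubtype_le {n k : ℕ} (f : Fin n → Fin n)
    (hf : ∀ x : Fin n, (x : ℕ) < k → k ≤ (f x : ℕ))
    (e : Equiv.Perm {x : Fin n // k ≤ (x : ℕ)}) :
    cycleCount (f ∘ Equiv.Perm.ofSubtype e) ≤ cycleCount (firstReturn f hf ∘ e) := by
  have hfix : ∀ x : Fin n, ¬ k ≤ (x : ℕ) → Equiv.Perm.ofSubtype e x = x := fun x hx =>
    Equiv.Perm.ofSubtype_apply_of_not_mem e hx
  refine le_trans (Set.ncard_le_ncard ?_ (Set.toFinite _))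
    (ncard_cycleSet_meeting_le (f := f ∘ Equiv.Perm.ofSubtype e) Subtype.val ?_)
  · intro C hC
    refine ⟨hC, ?_⟩
    obtain ⟨x, hx⟩ := cycleSet_nonempty hC
    by_cases hxk : k ≤ (x : ℕ)
    · exact ⟨⟨x, hxk⟩, hx⟩
    · have := iterate_mem_of_mem_cycleSet hC hx 1
      simp only [Function.iterate_one, Function.comp_apply, hfix x hxk] at this
      exact ⟨⟨f x, hf x (not_le.1 hxk)⟩, this⟩
  · intro x
    by_cases hx : k ≤ (f (e x) : ℕ)
    · refine ⟨1, ?_⟩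
      simp [firstReturn, hx]
    · refine ⟨2, ?_⟩
      simp [firstReturn, hx, hfix _ hx]

theorem sum_condMaps_pow_cycleCount_le (n k : ℕ) (z : ℝ) (hz : 1 ≤ z) :
    ((n - k).factorial : ℝ) * ∑ f ∈ condMaps n k, z ^ cycleCount f ≤
      (condMaps n k).card * ∏ i ∈ Finset.range (n - k), (z + i) := by
  have hcard : Fintype.card {x : Fin n // k ≤ (x : ℕ)} = n - k := by
    rw [← Fintype.card_fin (n - k)]
    exact Fintype.card_congr
      { toFun := fun x => ⟨x - k, by have := x.1.2; have := x.2; omega⟩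
        invFun := fun i => ⟨⟨i + k, by omega⟩, Nat.le_add_left _ _⟩
        left_inv := fun x => by ext; exact Nat.sub_add_cancel x.2
        right_inv := fun i => by ext; exact Nat.add_sub_cancel _ _ }
  have hinv : ∀ e : Equiv.Perm {x : Fin n // k ≤ (x : ℕ)},
      ∑ f ∈ condMaps n k, z ^ cycleCount (f ∘ Equiv.Perm.ofSubtype e) =
        ∑ f ∈ condMaps n k, z ^ cycleCount f := by
    intro e
    have hmem : ∀ (e : Equiv.Perm {x : Fin n // k ≤ (x : ℕ)}) (f : Fin n → Fin n),
        f ∈ condMaps n k → f ∘ Equiv.Perm.ofSubtype e ∈ condMaps n k := by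
      intro e f hf
      simp only [condMaps, Finset.mem_filter, Finset.mem_univ, true_and] at hf ⊢
      intro x hx
      rw [Function.comp_apply, Equiv.Perm.ofSubtype_apply_of_not_mem e (not_le.2 hx)]
      exact hf x hx
    refine Finset.sum_bij' (fun f _ => f ∘ Equiv.Perm.ofSubtype e)
      (fun f _ => f ∘ Equiv.Perm.ofSubtype e⁻¹) (fun f hf => hmem e f hf)
      (fun f hf => hmem e⁻¹ f hf) ?_ ?_ ?_
    · intro f _
      ext x
      simp
    · intro f _
      ext x
      simp
    · intro f _
      rfl
  calc ((n - k).factorial : ℝ) * ∑ f ∈ condMaps n k, z ^ cycleCount f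
      = ∑ e : Equiv.Perm {x : Fin n // k ≤ (x : ℕ)},
          ∑ f ∈ condMaps n k, z ^ cycleCount (f ∘ Equiv.Perm.ofSubtype e) := by
        rw [Finset.sum_congr rfl fun e _ => hinv e, Finset.sum_const, Finset.card_univ,
          Fintype.card_perm, hcard, nsmul_eq_mul]
    _ = ∑ f ∈ condMaps n k, ∑ e : Equiv.Perm {x : Fin n // k ≤ (x : ℕ)},
          z ^ cycleCount (f ∘ Equiv.Perm.ofSubtype e) := Finset.sum_comm
    _ ≤ ∑ f ∈ condMaps n k, ∏ i ∈ Finset.range (n - k), (z + i) := by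
        refine Finset.sum_le_sum fun f hf => ?_
        have hf : ∀ x : Fin n, (x : ℕ) < k → k ≤ (f x : ℕ) := by simpa [condMaps] using hf
        exact (Finset.sum_le_sum fun e _ => pow_le_pow_right₀ hz
          (cycleCount_comp_ofSubtype_le f hf e)).trans
          (sum_pow_cycleCount_comp_equiv_le z hz _ _ _ (firstReturn f hf) hcard hcard)
    _ = _ := by rw [Finset.sum_const, nsmul_eq_mul]

theorem prod_add_le_factorial_mul_exp (t : ℝ) (ht : 0 ≤ t) (m : ℕ) :
    ∏ i ∈ Finset.range m, (1 + t + i) ≤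
      (m.factorial : ℝ) * Real.exp (t * (1 + Real.log m)) := by
  have hprod : ∏ i ∈ Finset.range m, (1 + t + i) ≤
      (m.factorial : ℝ) * Real.exp (t * (harmonic m : ℝ)) := by
    induction m with
    | zero => simp
    | succ m ih =>
      have hstep : 1 + t + m ≤ (m + 1 : ℝ) * Real.exp (t * (m + 1 : ℝ)⁻¹) := by
        have := Real.add_one_le_exp (t * (m + 1 : ℝ)⁻¹)
        calc 1 + t + m = (m + 1 : ℝ) * (t * (m + 1 : ℝ)⁻¹ + 1) := by field_simp; ring
          _ ≤ _ := by gcongr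
      rw [Finset.prod_range_succ, harmonic_succ, Nat.factorial_succ]
      rw [Rat.cast_add, mul_add t, Real.exp_add]
      push_cast
      calc _ ≤ ((m.factorial : ℝ) * Real.exp (t * (harmonic m : ℝ))) *
            ((m + 1 : ℝ) * Real.exp (t * (m + 1 : ℝ)⁻¹)) := by gcongr
        _ = _ := by ring
  refine hprod.trans ?_
  gcongr
  exact harmonic_le_one_add_log m

/-- Chernoff bound for the number of cycles. -/
theorem condPr_cycleCount_gt_le (n k : ℕ) (t L : ℝ) (ht : 0 ≤ t) :
    condPr n k (fun f => (cycleCount f : ℝ) > (1 + t) * L) ≤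
      Real.exp (t * (1 + Real.log (n - k : ℕ)) - (1 + t) * L * Real.log (1 + t)) := by
  have hz : (1 : ℝ) ≤ 1 + t := by linarith
  refine div_le_of_le_mul₀ (by positivity) (by positivity) ?_
  have hmarkov : (((condMaps n k).filter fun f => (cycleCount f : ℝ) > (1 + t) * L).card : ℝ) *
      Real.exp ((1 + t) * L * Real.log (1 + t)) ≤ ∑ f ∈ condMaps n k, (1 + t) ^ cycleCount f := by
    rw [← nsmul_eq_mul]
    refine (Finset.card_nsmul_le_sum _ (fun f => (1 + t) ^ cycleCount f) _ ?_).trans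
      (Finset.sum_le_sum_of_subset_of_nonneg (Finset.filter_subset _ _)
        fun _ _ _ => by positivity)
    intro f hf
    have hf := (Finset.mem_filter.1 hf).2
    rw [← Real.rpow_natCast, Real.rpow_def_of_pos (by linarith), mul_comm (Real.log _)]
    have := Real.log_nonneg hz
    gcongr
  have hsum := sum_condMaps_pow_cycleCount_le n k (1 + t) hz
  have hprod := prod_add_le_factorial_mul_exp t ht (n - k)
  have hE : ∑ f ∈ condMaps n k, (1 + t) ^ cycleCount f ≤
      (condMaps n k).card * Real.exp (t * (1 + Real.log (n - k : ℕ))) := by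
    refine le_of_mul_le_mul_left (a := ((n - k).factorial : ℝ)) ?_ (by positivity)
    calc _ ≤ _ := hsum
      _ ≤ (condMaps n k).card * (((n - k).factorial : ℝ) *
          Real.exp (t * (1 + Real.log (n - k : ℕ)))) := by gcongr
      _ = _ := by ring
  rw [Real.exp_sub, div_mul_eq_mul_div, le_div_iff₀ (Real.exp_pos _), mul_comm (Real.exp _)]
  exact hmarkov.trans hE

theorem cycle_distribution_restricted_random_mapping (k : ℕ → ℕ)
    (hk : ∀ n, 2 ≤ n → 1 ≤ k n ∧ k n < n)
    (hdiff : Filter.Tendsto (fun n => n - k n) Filter.atTop Filter.atTop)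
    (t ε : ℝ) (ht : 0 < t) (hε : 0 < ε) :
    ∃ N : ℕ, ∀ n ≥ N,
      condPr n (k n)
          (fun f => (cycleCount f : ℝ) > (1 + t) * Real.log (n - k n)) ≤
        (1 + ε) * Real.exp (-(t ^ 2 / (2 + t)) * Real.log (n - k n) / 4) := by
  have hlog : Filter.Tendsto (fun n => Real.log ((n - k n : ℕ) : ℝ)) Filter.atTop Filter.atTop :=
    Real.tendsto_log_atTop.comp (tendsto_natCast_atTop_atTop.comp hdiff)
  have hlarge := hlog.eventually_ge_atTop (2 * t / (t ^ 2 / (2 + t)))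
  obtain ⟨N, hN⟩ := Filter.eventually_atTop.1 (hlarge.and (Filter.eventually_ge_atTop 2))
  refine ⟨N, fun n hn => ?_⟩
  obtain ⟨hL, hn2⟩ := hN n hn
  have hcast : ((n - k n : ℕ) : ℝ) = n - k n := Nat.cast_sub (hk n hn2).2.le
  have hb := condPr_cycleCount_gt_le n (k n) t (Real.log (n - k n)) ht.le
  rw [hcast] at hL hb
  set L := Real.log ((n : ℝ) - k n)
  set q := t ^ 2 / (2 + t) with hq
  have hq0 : 0 < q := by positivity
  have hL' : 2 * t ≤ L * q := (div_le_iff₀ hq0).1 hL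
  have hL0 : 0 ≤ L := le_trans (by positivity) hL
  have hrate : q + t ≤ (1 + t) * Real.log (1 + t) := by
    have h := Real.le_log_one_add_of_nonneg ht.le
    calc q + t = (1 + t) * (2 * t / (t + 2)) := by
          rw [hq, add_comm 2 t]; field_simp; ring
      _ ≤ _ := by gcongr
  have hexp : t * (1 + L) - (1 + t) * L * Real.log (1 + t) ≤ -q * L / 4 := by
    nlinarith [mul_le_mul_of_nonneg_left hrate hL0]
  calc _ ≤ _ := hb
    _ ≤ Real.exp (-q * L / 4) := Real.exp_le_exp.2 hexp
    _ ≤ _ := le_mul_of_one_le_left (Real.exp_pos _).le (by linarith)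
end

section
/- Let 1 ≤ k < n, S = {1,…,k}, S^c = {k+1,…,n}. Let F be a uniformly random function from {1,…,n} to {1,…,n} conditioned on F(S) ⊆ S^c, and let Ñ be the number of x ∈ S^c such that x ∉ F(S) and F(x) ∉ S. Then for all 0 < s < 1, P(Ñ < (1−s)·E[Ñ]) ≤ exp(−s²·E[Ñ]/2). -/
open scoped Classical

/-- `NSfun n k f` : the number of vertices `x ∈ Sᶜ` not adjacent to any vertex of
`S = {x | (x : ℕ) < k}` in the undirected functional graph of `f`. -/
noncomputable def NSfun (n k : ℕ) (f : Fin n → Fin n) : ℕ :=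
  Set.ncard {x : Fin n | k ≤ (x : ℕ) ∧ k ≤ (f x : ℕ) ∧
    ∀ s : Fin n, (s : ℕ) < k → f s ≠ x}

/-- Expectation of `NSfun n k` under the uniform distribution on `condMaps n k`. -/
noncomputable def condEN (n k : ℕ) : ℝ :=
  (∑ f ∈ condMaps n k, (NSfun n k f : ℝ)) / (condMaps n k).card

open Finset in
/-- Keeping only the terms of degree at most one in `b` bounds `∏ (a + b)` from below. -/
lemma prod_add_sum_mul_prod_erase_le_prod_add {ι : Type*} [DecidableEq ι] (U : Finset ι) (a b : ι → ℝ)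
    (ha : ∀ i, 0 ≤ a i) (hb : ∀ i, 0 ≤ b i) :
    ∏ i ∈ U, a i + ∑ j ∈ U, b j * ∏ i ∈ U.erase j, a i ≤ ∏ i ∈ U, (a i + b i) := by
  induction U using Finset.induction_on with
  | empty => simp
  | insert u U hu ih =>
    rw [prod_insert hu, prod_insert hu, sum_insert hu, erase_insert hu]
    have h : ∑ j ∈ U, b j * ∏ i ∈ (insert u U).erase j, a i
        = a u * ∑ j ∈ U, b j * ∏ i ∈ U.erase j, a i := by
      rw [mul_sum]
      refine sum_congr rfl fun j hj => ?_
      have hne : u ≠ j := fun e => hu (e ▸ hj)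
      rw [erase_insert_of_ne hne, prod_insert (fun h => hu (mem_of_mem_erase h))]
      ring
    rw [h]
    have h1 : ∏ i ∈ U, a i ≤ ∏ i ∈ U, (a i + b i) :=
      prod_le_prod (fun i _ => ha i) fun i _ => by linarith [hb i]
    nlinarith [mul_le_mul_of_nonneg_left ih (ha u), mul_le_mul_of_nonneg_left h1 (hb u)]

/-- The averaging step for one ball thrown uniformly into the boxes `B`. -/
lemma sum_prod_erase_le {B : Type*} [Fintype B] [DecidableEq B] [Nonempty B] (a : B → ℝ)
    (ha0 : ∀ x, 0 ≤ a x) (ha1 : ∀ x, a x ≤ 1) :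
    ∑ y, ∏ x ∈ Finset.univ.erase y, a x ≤
      Fintype.card B * ∏ x, (a x + (1 - a x) * (Fintype.card B : ℝ)⁻¹) := by
  have hm : (0 : ℝ) < Fintype.card B := by exact_mod_cast Fintype.card_pos
  have key := prod_add_sum_mul_prod_erase_le_prod_add Finset.univ a
    (fun x => (1 - a x) * (Fintype.card B : ℝ)⁻¹) ha0
    (fun x => mul_nonneg (by linarith [ha1 x]) (by positivity))
  refine le_trans (le_of_eq ?_) (mul_le_mul_of_nonneg_left key hm.le)
  have h : ∀ y : B, (1 - a y) * (Fintype.card B : ℝ)⁻¹ * ∏ x ∈ Finset.univ.erase y, a x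
      = (Fintype.card B : ℝ)⁻¹ * (∏ x ∈ Finset.univ.erase y, a x - ∏ x, a x) := by
    intro y
    rw [← Finset.mul_prod_erase Finset.univ a (Finset.mem_univ y)]
    ring
  simp only [h, ← Finset.mul_sum, Finset.sum_sub_distrib, Finset.sum_const, Finset.card_univ,
    nsmul_eq_mul]
  field_simp
  ring

/-- Negative dependence of the occupancy indicators of `k` balls thrown into the boxes `B`. -/
lemma sum_prod_one_sub_empty_le_fin {B : Type*} [Fintype B] [DecidableEq B] [Nonempty B] (k : ℕ) (w : B → ℝ)
    (hw0 : ∀ x, 0 ≤ w x) (hw1 : ∀ x, w x ≤ 1) :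
    ∑ g : Fin k → B, ∏ x, (1 - if ∃ a, g a = x then 0 else w x) ≤
      (Fintype.card B : ℝ) ^ k * ∏ x, (1 - w x * (1 - (Fintype.card B : ℝ)⁻¹) ^ k) := by
  have hm : (1 : ℝ) ≤ Fintype.card B := by exact_mod_cast Fintype.card_pos (α := B)
  have hq0 : 0 ≤ 1 - (Fintype.card B : ℝ)⁻¹ := by linarith [inv_le_one_of_one_le₀ hm]
  have hq1 : 1 - (Fintype.card B : ℝ)⁻¹ ≤ 1 := by
    have : 0 ≤ (Fintype.card B : ℝ)⁻¹ := by positivity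
    linarith
  induction k generalizing w with
  | zero => simp
  | succ k ih =>
    rw [← (Fin.consEquiv fun _ : Fin (k + 1) => B).sum_comp, Fintype.sum_prod_type]
    set q := (1 - (Fintype.card B : ℝ)⁻¹) ^ k with hq
    have hqk0 : 0 ≤ q := pow_nonneg hq0 k
    have hqk1 : q ≤ 1 := pow_le_one₀ hq0 hq1
    have step : ∀ y : B, ∑ g : Fin k → B,
        ∏ x, (1 - if ∃ a, (Fin.consEquiv fun _ : Fin (k + 1) => B) (y, g) a = x then 0 else w x)
          ≤ (Fintype.card B : ℝ) ^ k * ∏ x ∈ Finset.univ.erase y, (1 - w x * q) := by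
      intro y
      have hu0 : ∀ x, 0 ≤ Function.update w y 0 x := by
        intro x
        by_cases hx : x = y <;> simp [hx, hw0]
      have hu1 : ∀ x, Function.update w y 0 x ≤ 1 := by
        intro x
        by_cases hx : x = y <;> simp [hx, hw1]
      refine le_trans (le_of_eq ?_) ((ih (Function.update w y 0) hu0 hu1).trans (le_of_eq ?_))
      · refine Finset.sum_congr rfl fun g _ => Finset.prod_congr rfl fun x _ => ?_
        by_cases hx : x = y
        · subst hx
          simp [Fin.exists_fin_succ, Fin.consEquiv]
        · simp [Fin.exists_fin_succ, Fin.consEquiv, hx, Ne.symm hx]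
      · congr 1
        rw [← Finset.mul_prod_erase Finset.univ _ (Finset.mem_univ y)]
        simp only [Function.update_self, zero_mul, sub_zero, one_mul]
        refine Finset.prod_congr rfl fun x hx => ?_
        rw [Function.update_of_ne (Finset.ne_of_mem_erase hx)]
    refine (Finset.sum_le_sum fun y _ => step y).trans ?_
    rw [← Finset.mul_sum, pow_succ, mul_assoc]
    refine mul_le_mul_of_nonneg_left ?_ (by positivity)
    refine (sum_prod_erase_le (fun x => 1 - w x * q) ?_ ?_).trans (le_of_eq ?_)
    · intro x
      have := mul_le_one₀ (hw1 x) hqk0 hqk1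
      linarith
    · intro x
      have := mul_nonneg (hw0 x) hqk0
      linarith
    · congr 1
      refine Finset.prod_congr rfl fun x _ => ?_
      rw [pow_succ, ← hq]
      ring

lemma sum_prod_one_sub_empty_le {A B : Type*} [Fintype A] [DecidableEq A] [Fintype B]
    [DecidableEq B] [Nonempty B] (w : B → ℝ)
    (hw0 : ∀ x, 0 ≤ w x) (hw1 : ∀ x, w x ≤ 1) :
    ∑ g : A → B, ∏ x, (1 - if ∃ a, g a = x then 0 else w x) ≤
      (Fintype.card B : ℝ) ^ Fintype.card A *
        ∏ x, (1 - w x * (1 - (Fintype.card B : ℝ)⁻¹) ^ Fintype.card A) := by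
  refine le_trans (le_of_eq ?_) (sum_prod_one_sub_empty_le_fin (Fintype.card A) w hw0 hw1)
  rw [← ((Fintype.equivFin A).arrowCongr (Equiv.refl B)).sum_comp]
  refine Finset.sum_congr rfl fun g _ => Finset.prod_congr rfl fun x _ => ?_
  simp [(Fintype.equivFin A).symm.surjective.exists]

/-- The number of functions missing a given value. -/
lemma sum_indicator_empty {A B : Type*} [Fintype A] [DecidableEq A] [Fintype B]
    [DecidableEq B] (x : B) :
    ∑ g : A → B, (if ∃ a, g a = x then (0 : ℝ) else 1) =
      ((Fintype.card B : ℝ) - 1) ^ Fintype.card A := by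
  have h : (Finset.univ.filter fun g : A → B => ¬ ∃ a, g a = x) =
      Fintype.piFinset fun _ : A => Finset.univ.erase x := by
    ext g
    simp
  have hpos : 1 ≤ Fintype.card B := Fintype.card_pos_iff.mpr ⟨x⟩
  have : ∑ g : A → B, (if ∃ a, g a = x then (0 : ℝ) else 1) =
      ∑ g : A → B, (if ¬ ∃ a, g a = x then (1 : ℝ) else 0) :=
    Finset.sum_congr rfl fun g _ => by split_ifs <;> simp_all
  rw [this, Finset.sum_boole, h, Fintype.card_piFinset]
  simp [Finset.card_erase_of_mem, Nat.cast_sub hpos]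

/-- The vertices of `S`. -/
abbrev LowVertex (n k : ℕ) := {x : Fin n // (x : ℕ) < k}

/-- The vertices of `Sᶜ`. -/
abbrev HighVertex (n k : ℕ) := {x : Fin n // ¬ (x : ℕ) < k}

lemma card_lowVertex {n k : ℕ} (hkn : k < n) : Fintype.card (LowVertex n k) = k := by
  rw [Fintype.card_subtype]
  have : (Finset.univ.filter fun x : Fin n => (x : ℕ) < k) = Finset.Iio ⟨k, hkn⟩ := by
    ext x
    simp [Fin.lt_def]
  rw [this, Fin.card_Iio]

lemma card_highVertex {n k : ℕ} (hkn : k < n) : Fintype.card (HighVertex n k) = n - k := by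
  have h := Fintype.card_subtype_compl (fun x : Fin n => (x : ℕ) < k)
  rw [Fintype.card_fin] at h
  rw [h, card_lowVertex hkn]

/-- The map on `Fin n` with prescribed restrictions to `S` and `Sᶜ`. -/
def glue {n k : ℕ} (g : LowVertex n k → HighVertex n k) (h : HighVertex n k → Fin n) (x : Fin n) :
    Fin n :=
  if hx : (x : ℕ) < k then (g ⟨x, hx⟩ : Fin n) else h ⟨x, hx⟩

lemma sum_condMaps {n k : ℕ} (φ : (Fin n → Fin n) → ℝ) :
    ∑ f ∈ condMaps n k, φ f =
      ∑ g : LowVertex n k → HighVertex n k, ∑ h : HighVertex n k → Fin n, φ (glue g h) := by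
  rw [← Fintype.sum_prod_type' fun (g : LowVertex n k → HighVertex n k)
    (h : HighVertex n k → Fin n) => φ (glue g h)]
  symm
  refine Finset.sum_bij (fun p _ => glue p.1 p.2) ?_ ?_ ?_ (fun _ _ => rfl)
  · rintro ⟨g, h⟩ -
    simp only [condMaps, Finset.mem_filter, Finset.mem_univ, true_and]
    intro x hx
    simp only [glue, hx, dif_pos]
    exact not_lt.mp (g ⟨x, hx⟩).2
  · rintro ⟨g, h⟩ - ⟨g', h'⟩ - he
    refine Prod.ext (funext fun x => Subtype.ext ?_) (funext fun x => ?_)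
    · simpa [glue, x.2] using congrFun he x.1
    · have := congrFun he x.1
      simp only [glue, x.2, dif_neg, not_false_eq_true] at this
      exact this
  · intro f hf
    simp only [condMaps, Finset.mem_filter, Finset.mem_univ, true_and] at hf
    refine ⟨(fun x => ⟨f x, not_lt.mpr (hf x x.2)⟩, fun x => f x), Finset.mem_univ _, ?_⟩
    funext x
    simp [glue]

/-- The indicator that `x` has no neighbour in `S`. -/
noncomputable def farIndicator {n k : ℕ} (f : Fin n → Fin n) (x : HighVertex n k) : ℝ :=
  if ∃ a : LowVertex n k, f a = x then 0 else if (f x : ℕ) < k then 0 else 1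

lemma NSfun_eq_card (n k : ℕ) (f : Fin n → Fin n) :
    NSfun n k f = (Finset.univ.filter fun x : HighVertex n k =>
      (¬ ∃ a : LowVertex n k, f a = x) ∧ ¬ (f x : ℕ) < k).card := by
  rw [← Finset.card_map (Function.Embedding.subtype _), NSfun, ← Set.ncard_coe_finset]
  congr 1
  ext x
  simp only [Set.mem_ofPred_eq, Finset.coe_map, Finset.coe_filter, Finset.mem_univ, true_and,
    Set.mem_image, Function.Embedding.subtype_apply]
  constructor
  · rintro ⟨h1, h2, h3⟩
    exact ⟨⟨x, not_lt.mpr h1⟩, ⟨fun ⟨a, ha⟩ => h3 a a.2 ha, not_lt.mpr h2⟩, rfl⟩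
  · rintro ⟨y, ⟨h3, h2⟩, rfl⟩
    exact ⟨not_lt.mp y.2, not_lt.mp h2, fun a ha he => h3 ⟨⟨a, ha⟩, he⟩⟩

lemma farIndicator_eq {n k : ℕ} (f : Fin n → Fin n) (x : HighVertex n k) :
    farIndicator f x =
      if (¬ ∃ a : LowVertex n k, f a = x) ∧ ¬ (f x : ℕ) < k then 1 else 0 := by
  unfold farIndicator
  split_ifs <;> simp_all

lemma NSfun_eq_sum (n k : ℕ) (f : Fin n → Fin n) :
    (NSfun n k f : ℝ) = ∑ x : HighVertex n k, farIndicator f x := by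
  simp only [farIndicator_eq, Finset.sum_boole, NSfun_eq_card]

lemma one_sub_pow_NSfun (n k : ℕ) (f : Fin n → Fin n) (s : ℝ) :
    (1 - s) ^ NSfun n k f = ∏ x : HighVertex n k, (1 - s * farIndicator f x) := by
  rw [NSfun_eq_card, ← Finset.prod_const, Finset.prod_filter]
  refine Finset.prod_congr rfl fun x _ => ?_
  rw [farIndicator_eq]
  split_ifs <;> simp

lemma farIndicator_glue {n k : ℕ} (g : LowVertex n k → HighVertex n k) (h : HighVertex n k → Fin n)
    (x : HighVertex n k) :
    farIndicator (glue g h) x =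
      if ∃ a, g a = x then 0 else if (h x : ℕ) < k then 0 else 1 := by
  have h1 : ∀ a : LowVertex n k, glue g h a = g a := fun a => by simp [glue, a.2]
  have h2 : glue g h x = h x := by
    simp only [glue, x.2, dif_neg, not_false_eq_true]
  simp only [farIndicator, h1, h2, Subtype.ext_iff]

/-- Averaging out the restriction of the random map to `Sᶜ`. -/
lemma sum_condMaps_prod {n k : ℕ} (hkn : k < n) (w : HighVertex n k → ℝ) :
    ∑ f ∈ condMaps n k, ∏ x : HighVertex n k, (1 - w x * farIndicator f x) =
      (n : ℝ) ^ (n - k) * ∑ g : LowVertex n k → HighVertex n k,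
        ∏ x, (1 - if ∃ a, g a = x then 0 else w x * ((n - k : ℕ) / n : ℝ)) := by
  have hn : (n : ℝ) ≠ 0 := by
    have : n ≠ 0 := by omega
    exact_mod_cast this
  rw [sum_condMaps, Finset.mul_sum]
  refine Finset.sum_congr rfl fun g _ => ?_
  simp only [farIndicator_glue]
  have := Finset.prod_univ_sum (fun _ : HighVertex n k => (Finset.univ : Finset (Fin n)))
    (fun x y => 1 - w x * if ∃ a, g a = x then 0 else if (y : ℕ) < k then 0 else 1)
  rw [Fintype.piFinset_univ] at this
  rw [← this]
  have hc : (n : ℝ) ^ (n - k) = ∏ _x : HighVertex n k, (n : ℝ) := by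
    rw [Finset.prod_const, Finset.card_univ, card_highVertex hkn]
  rw [hc, ← Finset.prod_mul_distrib]
  refine Finset.prod_congr rfl fun x _ => ?_
  by_cases hx : ∃ a, g a = x
  · simp [hx]
  · have hs : ∑ y : Fin n, (if (y : ℕ) < k then (0 : ℝ) else 1) = (n - k : ℕ) := by
      rw [← card_highVertex hkn, Fintype.card_subtype, Finset.card_filter]
      push_cast
      exact Finset.sum_congr rfl fun y _ => by split_ifs <;> simp_all
    simp only [hx, if_false, Finset.sum_sub_distrib, ← Finset.mul_sum, hs]
    simp
    field_simp

lemma card_condMaps {n k : ℕ} (hkn : k < n) :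
    ((condMaps n k).card : ℝ) = (n : ℝ) ^ (n - k) * ((n - k : ℕ) : ℝ) ^ k := by
  have := sum_condMaps (n := n) (k := k) fun _ => 1
  simp only [Finset.sum_const, nsmul_eq_mul, mul_one, Finset.card_univ, Fintype.card_fun,
    card_highVertex hkn, card_lowVertex hkn, Fintype.card_fin] at this
  rw [this]
  push_cast
  ring

lemma sum_condMaps_farIndicator {n k : ℕ} (hkn : k < n) (x : HighVertex n k) :
    ∑ f ∈ condMaps n k, farIndicator f x =
      (n : ℝ) ^ (n - k) * (((n - k : ℕ) / n : ℝ) * (((n - k : ℕ) : ℝ) - 1) ^ k) := by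
  have key := sum_condMaps_prod hkn (Pi.single x 1)
  have h1 : ∀ u : HighVertex n k → ℝ, ∏ y, (1 - (Pi.single x 1 : HighVertex n k → ℝ) y * u y)
      = 1 - u x := by
    intro u
    rw [Finset.prod_eq_single x (fun y _ hy => by simp [hy]) (by simp)]
    simp
  have h2 : ∀ g : LowVertex n k → HighVertex n k,
      ∏ y, (1 - if ∃ a, g a = y then 0 else
        (Pi.single x 1 : HighVertex n k → ℝ) y * ((n - k : ℕ) / n : ℝ))
      = 1 - ((n - k : ℕ) / n : ℝ) * if ∃ a, g a = x then 0 else 1 := by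
    intro g
    rw [Finset.prod_eq_single x (fun y _ hy => by simp [hy]) (by simp)]
    simp
  simp only [h1, h2, Finset.sum_sub_distrib, ← Finset.mul_sum, sum_indicator_empty,
    Finset.sum_const, nsmul_eq_mul, mul_one, card_condMaps hkn, Finset.card_univ,
    Fintype.card_fun, card_highVertex hkn, card_lowVertex hkn] at key
  push_cast at key
  linarith

lemma condEN_eq {n k : ℕ} (hkn : k < n) :
    condEN n k = ((n - k : ℕ) : ℝ) *
      (((n - k : ℕ) / n : ℝ) * (1 - ((n - k : ℕ) : ℝ)⁻¹) ^ k) := by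
  have hn : (n : ℝ) ≠ 0 := by
    have : n ≠ 0 := by omega
    exact_mod_cast this
  have hm : ((n - k : ℕ) : ℝ) ≠ 0 := by
    have : n - k ≠ 0 := by omega
    exact_mod_cast this
  have hq : (1 - ((n - k : ℕ) : ℝ)⁻¹) ^ k =
      (((n - k : ℕ) : ℝ) - 1) ^ k / ((n - k : ℕ) : ℝ) ^ k := by
    rw [← div_pow]
    congr 1
    field_simp
  unfold condEN
  simp only [NSfun_eq_sum]
  rw [Finset.sum_comm]
  simp only [sum_condMaps_farIndicator hkn, Finset.sum_const, Finset.card_univ,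
    card_highVertex hkn, nsmul_eq_mul, card_condMaps hkn, hq]
  field_simp

/-- The bound on the moment generating function of `NSfun`. -/
lemma sum_one_sub_pow_NSfun_le {n k : ℕ} (hkn : k < n) {s : ℝ} (hs0 : 0 ≤ s) (hs1 : s ≤ 1) :
    ∑ f ∈ condMaps n k, (1 - s) ^ NSfun n k f ≤
      (condMaps n k).card * Real.exp (-(s * condEN n k)) := by
  have : Nonempty (HighVertex n k) := ⟨⟨⟨k, hkn⟩, lt_irrefl k⟩⟩
  have hn : (0 : ℝ) < n := by exact_mod_cast (by omega : 0 < n)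
  have hp0 : (0 : ℝ) ≤ (n - k : ℕ) / n := by positivity
  have hp1 : ((n - k : ℕ) / n : ℝ) ≤ 1 := by
    rw [div_le_one hn]
    exact_mod_cast Nat.sub_le n k
  have hm : (1 : ℝ) ≤ (n - k : ℕ) := by exact_mod_cast (by omega : 1 ≤ n - k)
  have hq0 : 0 ≤ 1 - ((n - k : ℕ) : ℝ)⁻¹ := by linarith [inv_le_one_of_one_le₀ hm]
  have hq1 : 1 - ((n - k : ℕ) : ℝ)⁻¹ ≤ 1 := by
    have : 0 ≤ ((n - k : ℕ) : ℝ)⁻¹ := by positivity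
    linarith
  simp only [one_sub_pow_NSfun]
  rw [sum_condMaps_prod hkn fun _ => s, card_condMaps hkn, mul_assoc]
  refine mul_le_mul_of_nonneg_left ?_ (by positivity)
  refine (sum_prod_one_sub_empty_le (A := LowVertex n k) (B := HighVertex n k)
    (fun _ => s * ((n - k : ℕ) / n : ℝ)) (fun _ => by positivity)
    (fun _ => mul_le_one₀ hs1 hp0 hp1)).trans ?_
  rw [card_lowVertex hkn, card_highVertex hkn, Finset.prod_const, Finset.card_univ,
    card_highVertex hkn]
  refine mul_le_mul_of_nonneg_left ?_ (by positivity)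
  set c := s * ((n - k : ℕ) / n : ℝ) * (1 - ((n - k : ℕ) : ℝ)⁻¹) ^ k with hc
  have hc1 : c ≤ 1 :=
    mul_le_one₀ (mul_le_one₀ hs1 hp0 hp1) (pow_nonneg hq0 k) (pow_le_one₀ hq0 hq1)
  calc (1 - c) ^ (n - k) ≤ Real.exp (-c) ^ (n - k) :=
        pow_le_pow_left₀ (by linarith) (Real.one_sub_le_exp_neg c) _
    _ = Real.exp (-(s * condEN n k)) := by
        rw [← Real.exp_nat_mul, condEN_eq hkn, hc]
        congr 1
        ring

lemma sq_half_le_add_mul_log {s : ℝ} (hs0 : 0 ≤ s) (hs1 : s < 1) :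
    s ^ 2 / 2 ≤ s + (1 - s) * Real.log (1 - s) := by
  have hr : 0 < 1 - s := by linarith
  have hlog : 0 ≤ Real.log (1 - s)⁻¹ := Real.log_nonneg ((one_le_inv₀ hr).mpr (by linarith))
  have h := Real.self_le_sinh_iff.mpr hlog
  rw [Real.sinh_log (inv_pos.mpr hr), inv_inv, Real.log_inv] at h
  have h' := mul_le_mul_of_nonneg_left h hr.le
  have : (1 - s) * (((1 - s)⁻¹ - (1 - s)) / 2) = (1 - (1 - s) ^ 2) / 2 := by
    field_simp
  nlinarith

theorem mapping_concentration_lower_tail (n k : ℕ) (hk : 1 ≤ k) (hkn : k < n)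
    (s : ℝ) (hs0 : 0 < s) (hs1 : s < 1) :
    condPr n k (fun f => (NSfun n k f : ℝ) < (1 - s) * condEN n k) ≤
      Real.exp (-(s ^ 2 * condEN n k / 2)) := by
  have hr : 0 < 1 - s := by linarith
  have hE : 0 ≤ condEN n k := by
    unfold condEN
    positivity
  have hcard : (0 : ℝ) < (condMaps n k).card := by
    have : 0 < n - k := by omega
    have : 0 < n := by omega
    rw [card_condMaps hkn]
    positivity
  set t := Real.exp (Real.log (1 - s) * ((1 - s) * condEN n k)) with ht
  have htpos : 0 < t := Real.exp_pos _
  have hlog : Real.log (1 - s) ≤ 0 := Real.log_nonpos hr.le (by linarith)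
  have markov : (((condMaps n k).filter
      fun f => (NSfun n k f : ℝ) < (1 - s) * condEN n k).card : ℝ) * t ≤
      ∑ f ∈ condMaps n k, (1 - s) ^ NSfun n k f := by
    rw [← nsmul_eq_mul, ← Finset.sum_const]
    refine (Finset.sum_le_sum fun f hf => ?_).trans
      (Finset.sum_le_sum_of_subset_of_nonneg (Finset.filter_subset _ _)
        fun f _ _ => pow_nonneg hr.le _)
    have hf := (Finset.mem_filter.mp hf).2
    rw [← Real.rpow_natCast, Real.rpow_def_of_pos hr, ht]
    exact Real.exp_le_exp.mpr (mul_le_mul_of_nonpos_left hf.le hlog)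
  have hbound := markov.trans (sum_one_sub_pow_NSfun_le hkn hs0.le hs1.le)
  have hexp : Real.exp (-(s * condEN n k)) ≤ Real.exp (-(s ^ 2 * condEN n k / 2)) * t := by
    rw [ht, ← Real.exp_add, Real.exp_le_exp]
    have := mul_le_mul_of_nonneg_right (sq_half_le_add_mul_log hs0.le hs1) hE
    linarith
  unfold condPr
  rw [div_le_iff₀ hcard]
  refine le_of_mul_le_mul_right ?_ htpos
  calc _ ≤ _ := hbound
    _ ≤ (condMaps n k).card * (Real.exp (-(s ^ 2 * condEN n k / 2)) * t) :=
        mul_le_mul_of_nonneg_left hexp hcard.le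
    _ = _ := by ring
end
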